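/- arXiv:0911.2227 — 13 statements merged into one kernel-verified Lean document; each statement's English description precedes it below -/
import Mathlib

section
/- Monotonicity in the parameter: let σ > 0, s > 0, T ∈ (0, ∞] and 0 < a₁ < a₂. Suppose f₁, f₂ : [0, T) → (0, ∞) are continuous and satisfy, for i = 1, 2 and all t ∈ [0, T), −a_i t^{1/3} + f_i(t) + (π²σ²/2)∫₀ᵗ f_i(u)^{−2} du = s. Then f₁(t) ≤ f₂(t) for all t ∈ [0, T). -/
open MeasureTheory Filter Set

/-- The critical constant `a_c = (3/2)(3π²σ²)^{1/3}`. -/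
noncomputable def aCrit (σ : ℝ) : ℝ := (3/2) * (3 * Real.pi ^ 2 * σ ^ 2) ^ ((1:ℝ)/3)

/-- The interval `[0, T)` for `T ∈ (0, ∞]` (an extended real). -/
def barrierDomain (T : EReal) : Set ℝ := {t : ℝ | 0 ≤ t ∧ (t : EReal) < T}

/-- `f : [0,T) → (0,∞)` is a solution of the barrier equation with parameter `a`
and initial value `s`: it is continuous, positive, and satisfies the integrated ODE
`f(t) + (π²σ²/2) ∫₀ᵗ f(u)⁻² du = s + a t^{1/3}` on `[0,T)`. -/
def IsBarrierSolution (σ a s : ℝ) (T : EReal) (f : ℝ → ℝ) : Prop :=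
  ContinuousOn f (barrierDomain T) ∧
  (∀ t ∈ barrierDomain T, 0 < f t) ∧
  (∀ t ∈ barrierDomain T,
    f t + Real.pi ^ 2 * σ ^ 2 / 2 * (∫ u in Set.Ioc (0:ℝ) t, ((f u) ^ 2)⁻¹)
      = s + a * t ^ ((1:ℝ)/3))


lemma aux_gronwall (p : ℝ → ℝ) (hp : Continuous p) (hp0 : ∀ u, 0 ≤ p u) (K t : ℝ)
    (h : ∀ u ∈ Icc 0 t, p u ≤ K * ∫ x in (0:ℝ)..u, p x) :
    ∀ u ∈ Icc 0 t, p u = 0 := by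
  have hd : ∀ u, HasDerivAt (fun u => ∫ x in (0:ℝ)..u, p x) (p u) u := fun u =>
    intervalIntegral.integral_hasDerivAt_right (hp.intervalIntegrable _ _)
      hp.stronglyMeasurable.stronglyMeasurableAtFilter hp.continuousAt
  have key : ∀ u ∈ Icc 0 t, ‖∫ x in (0:ℝ)..u, p x‖ ≤ gronwallBound 0 K 0 (u - 0) := by
    apply norm_le_gronwallBound_of_norm_deriv_right_le (f' := p)
    · exact fun u _ => (hd u).continuousAt.continuousWithinAt
    · exact fun u _ => (hd u).hasDerivWithinAt
    · simp
    · intro u hu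
      have h0 : 0 ≤ ∫ x in (0:ℝ)..u, p x :=
        intervalIntegral.integral_nonneg hu.1 (fun x _ => hp0 x)
      rw [Real.norm_of_nonneg (hp0 u), Real.norm_of_nonneg h0, add_zero]
      exact h u ⟨hu.1, hu.2.le⟩
  intro u hu
  have h1 := key u hu
  rw [gronwallBound_ε0_δ0] at h1
  have h2 := norm_le_zero_iff.1 h1
  have h3 := h u hu
  rw [h2, mul_zero] at h3
  exact le_antisymm h3 (hp0 u)

lemma aux_lip (m x y : ℝ) (hm : 0 < m) (hx : m ≤ x) (hy : m ≤ y) :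
    (y ^ 2)⁻¹ - (x ^ 2)⁻¹ ≤ 2 / m ^ 3 * max 0 (x - y) := by
  have hx0 : 0 < x := by linarith
  have hy0 : 0 < y := by linarith
  rcases le_total x y with h | h
  · rw [max_eq_left (by linarith), mul_zero]
    have : (y ^ 2)⁻¹ ≤ (x ^ 2)⁻¹ := by gcongr
    linarith
  · rw [max_eq_right (by linarith)]
    have e : (y ^ 2)⁻¹ - (x ^ 2)⁻¹ = (1 / (x * y ^ 2) + 1 / (x ^ 2 * y)) * (x - y) := by
      field_simp
      ring
    have e1 : 1 / (x * y ^ 2) ≤ 1 / (m * m ^ 2) := by gcongr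
    have e2 : 1 / (x ^ 2 * y) ≤ 1 / (m ^ 2 * m) := by gcongr
    have e3 : 2 / m ^ 3 = 1 / (m * m ^ 2) + 1 / (m ^ 2 * m) := by
      field_simp
      norm_num
    rw [e, e3]
    exact mul_le_mul_of_nonneg_right (add_le_add e1 e2) (by linarith)

/-- Monotonicity of barrier solutions in the parameter `a`. -/
theorem barrier_solution_mono_in_a
    (σ s : ℝ) (hσ : 0 < σ) (hs : 0 < s)
    (T : EReal) (hT : 0 < T)
    (a₁ a₂ : ℝ) (ha₁ : 0 < a₁) (ha₁₂ : a₁ < a₂)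
    (f₁ f₂ : ℝ → ℝ)
    (h₁ : IsBarrierSolution σ a₁ s T f₁)
    (h₂ : IsBarrierSolution σ a₂ s T f₂) :
    ∀ t ∈ barrierDomain T, f₁ t ≤ f₂ t := by
  intro t ht
  have ht0 : 0 ≤ t := ht.1
  have hsub : Icc 0 t ⊆ barrierDomain T := fun u hu =>
    ⟨hu.1, lt_of_le_of_lt (EReal.coe_le_coe_iff.2 hu.2) ht.2⟩
  obtain ⟨c₁, p₁, e₁⟩ := h₁
  obtain ⟨c₂, p₂, e₂⟩ := h₂
  set c := Real.pi ^ 2 * σ ^ 2 / 2 with hc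
  have hc0 : 0 ≤ c := by positivity
  have hne : (Icc 0 t).Nonempty := ⟨0, le_rfl, ht0⟩
  obtain ⟨x₁, hx₁, m₁⟩ := isCompact_Icc.exists_isMinOn hne (c₁.mono hsub)
  obtain ⟨x₂, hx₂, m₂⟩ := isCompact_Icc.exists_isMinOn hne (c₂.mono hsub)
  set m := min (f₁ x₁) (f₂ x₂) with hm
  have hm0 : 0 < m := lt_min (p₁ _ (hsub hx₁)) (p₂ _ (hsub hx₂))
  have b₁ : ∀ u ∈ Icc 0 t, m ≤ f₁ u := fun u hu => (min_le_left _ _).trans (m₁ hu)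
  have b₂ : ∀ u ∈ Icc 0 t, m ≤ f₂ u := fun u hu => (min_le_right _ _).trans (m₂ hu)
  let q : ℝ → ℝ := fun u => max 0 (f₁ (projIcc 0 t ht0 u) - f₂ (projIcc 0 t ht0 u))
  have hpc : Continuous (fun u => ((projIcc 0 t ht0 u : Icc 0 t) : ℝ)) :=
    continuous_subtype_val.comp continuous_projIcc
  have hq : Continuous q := continuous_const.max
    (((c₁.mono hsub).comp_continuous hpc (fun u => (projIcc 0 t ht0 u).2)).sub
      ((c₂.mono hsub).comp_continuous hpc (fun u => (projIcc 0 t ht0 u).2)))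
  have hqe : ∀ u ∈ Icc 0 t, q u = max 0 (f₁ u - f₂ u) := by
    intro u hu
    simp only [q, projIcc_of_mem ht0 hu]
  have hi : ∀ f : ℝ → ℝ, ContinuousOn f (Icc 0 t) → (∀ u ∈ Icc 0 t, m ≤ f u) →
      ∀ u ∈ Icc 0 t, IntervalIntegrable (fun x => ((f x) ^ 2)⁻¹) volume 0 u := by
    intro f hf hb u hu
    apply ContinuousOn.intervalIntegrable
    rw [uIcc_of_le hu.1]
    have hs' : Icc 0 u ⊆ Icc 0 t := Icc_subset_Icc_right hu.2
    apply ContinuousOn.inv₀ ((hf.mono hs').pow 2)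
    intro x hx
    have := hb x (hs' hx)
    have : 0 < f x := by linarith
    exact (pow_pos this 2).ne'
  have key := aux_gronwall q hq (fun u => le_max_left _ _) (c * (2 / m ^ 3)) t ?_ t ⟨ht0, le_rfl⟩
  · rw [hqe t ⟨ht0, le_rfl⟩] at key
    have := le_max_right 0 (f₁ t - f₂ t)
    linarith
  intro u hu
  have g₁ := e₁ u (hsub hu)
  have g₂ := e₂ u (hsub hu)
  rw [← intervalIntegral.integral_of_le hu.1] at g₁ g₂
  have i₁ := hi f₁ (c₁.mono hsub) b₁ u hu
  have i₂ := hi f₂ (c₂.mono hsub) b₂ u hu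
  have hI : (∫ x in (0:ℝ)..u, ((f₂ x) ^ 2)⁻¹) - (∫ x in (0:ℝ)..u, ((f₁ x) ^ 2)⁻¹)
      ≤ 2 / m ^ 3 * ∫ x in (0:ℝ)..u, q x := by
    rw [← intervalIntegral.integral_sub i₂ i₁, ← intervalIntegral.integral_const_mul]
    apply intervalIntegral.integral_mono_on hu.1 (i₂.sub i₁)
      ((hq.const_mul _).intervalIntegrable _ _)
    intro x hx
    have hx' : x ∈ Icc 0 t := ⟨hx.1, hx.2.trans hu.2⟩
    rw [hqe x hx']
    exact aux_lip m _ _ hm0 (b₁ x hx') (b₂ x hx')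
  have hI' := mul_le_mul_of_nonneg_left hI hc0
  have hr : 0 ≤ (a₂ - a₁) * u ^ ((1:ℝ)/3) :=
    mul_nonneg (by linarith) (Real.rpow_nonneg hu.1 _)
  have hq0 : 0 ≤ ∫ x in (0:ℝ)..u, q x :=
    intervalIntegral.integral_nonneg hu.1 (fun x _ => le_max_left _ _)
  rw [hqe u hu]
  apply max_le
  · positivity
  · rw [mul_assoc]
    linarith
end

section
/- Dichotomy for maximal solutions: let s > 0 and let f : [0, T) → (0, ∞) be a solution of the barrier equation with parameter a and initial value s which is maximal, i.e. there is no T' with T < T' ≤ ∞ and no solution g : [0, T') → (0, ∞) of the barrier equation with parameter a and initial value s such that g agrees with f on [0, T). Then either (A) T = ∞ and f(t) → +∞ as t → ∞, or (B) T < ∞ and f(t) → 0 as t → T⁻. -/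
open MeasureTheory Filter Set

lemma barrier_local_existence (c a T L : ℝ) (hT : 0 < T) (hL : 0 < L) :
    ∃ ε > 0, ∃ y : ℝ → ℝ, y T = L ∧ ∀ t ∈ Ioo (T - ε) (T + ε), 0 < y t ∧
      HasDerivAt y (a * ((1:ℝ)/3 * t ^ ((1:ℝ)/3 - 1)) - c * ((y t) ^ 2)⁻¹) t := by
  let v : ℝ × ℝ → ℝ × ℝ := fun p => (1, a * ((1:ℝ)/3 * p.1 ^ ((1:ℝ)/3 - 1)) - c * (p.2 ^ 2)⁻¹)
  have hv : ContDiffAt ℝ 1 v (T, L) := by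
    apply ContDiffAt.prodMk contDiffAt_const
    apply ContDiffAt.sub
    · apply ContDiffAt.mul contDiffAt_const
      apply ContDiffAt.mul contDiffAt_const
      exact contDiffAt_fst.rpow_const_of_ne hT.ne'
    · apply ContDiffAt.mul contDiffAt_const
      apply ContDiffAt.inv (contDiffAt_snd.pow 2)
      simpa using hL.ne'
  obtain ⟨α, hα0, ε, hε, hα⟩ :=
    hv.exists_forall_mem_closedBall_exists_eq_forall_mem_Ioo_hasDerivAt₀ T
  have hTm : T ∈ Ioo (T - ε) (T + ε) := ⟨by linarith, by linarith⟩
  have h1 : ∀ t ∈ Ioo (T - ε) (T + ε), HasDerivAt (fun t => (α t).1) 1 t := fun t ht =>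
    ((ContinuousLinearMap.fst ℝ ℝ ℝ).hasFDerivAt.comp_hasDerivAt t (hα t ht))
  have h2 : ∀ t ∈ Ioo (T - ε) (T + ε), HasDerivAt (fun t => (α t).2)
      (a * ((1:ℝ)/3 * (α t).1 ^ ((1:ℝ)/3 - 1)) - c * ((α t).2 ^ 2)⁻¹) t := fun t ht =>
    ((ContinuousLinearMap.snd ℝ ℝ ℝ).hasFDerivAt.comp_hasDerivAt t (hα t ht))
  have h3 : ∀ t ∈ Ioo (T - ε) (T + ε), (α t).1 = t := by
    intro t ht
    have := isOpen_Ioo.is_const_of_deriv_eq_zero (isPreconnected_Ioo (a := T - ε) (b := T + ε))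
      (f := fun t => (α t).1 - t)
      (fun x hx => ((h1 x hx).sub (hasDerivAt_id x)).differentiableAt.differentiableWithinAt)
      (fun x hx => by
        have := ((h1 x hx).sub (hasDerivAt_id x)).deriv
        rw [sub_self] at this
        exact this) ht hTm
    simp only [hα0] at this
    linarith
  have hc : ContinuousAt (fun t => (α t).2) T := (h2 T hTm).continuousAt
  have hpos : ∀ᶠ t in nhds T, 0 < (α t).2 := by
    apply hc.eventually
    apply lt_mem_nhds
    simpa [hα0] using hL
  obtain ⟨δ, hδ, hδ'⟩ := Metric.eventually_nhds_iff_ball.1 hpos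
  refine ⟨min δ ε, lt_min hδ hε, fun t => (α t).2, by simp [hα0], fun t ht => ?_⟩
  have m1 := min_le_left δ ε
  have m2 := min_le_right δ ε
  have ht2 : t ∈ Ioo (T - ε) (T + ε) := ⟨by linarith [ht.1], by linarith [ht.2]⟩
  refine ⟨hδ' t ?_, ?_⟩
  · rw [Real.ball_eq_Ioo]
    exact ⟨by linarith [ht.1], by linarith [ht.2]⟩
  · have := h2 t ht2
    rwa [h3 t ht2] at this

lemma barrier_inv_cont {g : ℝ → ℝ} {S : Set ℝ} (hg : ContinuousOn g S)
    (hp : ∀ t ∈ S, 0 < g t) : ContinuousOn (fun t => ((g t) ^ 2)⁻¹) S :=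
  (hg.pow 2).inv₀ fun t ht => pow_ne_zero 2 (hp t ht).ne'

/-- interval-integral form of the equation, with the integrand's continuity -/
lemma barrier_hasDerivAt {c a s : ℝ} {T : EReal} {f : ℝ → ℝ}
    (hc : ContinuousOn f (barrierDomain T)) (hp : ∀ t ∈ barrierDomain T, 0 < f t)
    (he : ∀ t ∈ barrierDomain T, f t + c * (∫ u in Set.Ioc (0:ℝ) t, ((f u) ^ 2)⁻¹)
      = s + a * t ^ ((1:ℝ)/3)) (t : ℝ) (ht : 0 < t) (htT : (t : EReal) < T) :
    HasDerivAt f (a * ((1:ℝ)/3 * t ^ ((1:ℝ)/3 - 1)) - c * ((f t) ^ 2)⁻¹) t := by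
  have hO : IsOpen {u : ℝ | 0 < u ∧ (u : EReal) < T} :=
    (isOpen_lt continuous_const continuous_id).inter
      (isOpen_lt continuous_coe_real_ereal continuous_const)
  have hsub : {u : ℝ | 0 < u ∧ (u : EReal) < T} ⊆ barrierDomain T := fun u hu => ⟨hu.1.le, hu.2⟩
  have hi := barrier_inv_cont hc hp
  have hi2 : IntervalIntegrable (fun u => ((f u) ^ 2)⁻¹) volume 0 t := by
    apply ContinuousOn.intervalIntegrable_of_Icc ht.le
    exact hi.mono fun u hu => ⟨hu.1, lt_of_le_of_lt (EReal.coe_le_coe_iff.2 hu.2) htT⟩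
  have hm := (hi.mono hsub).stronglyMeasurableAtFilter hO (μ := volume) t ⟨ht, htT⟩
  have hca := (hi.mono hsub).continuousAt (hO.mem_nhds ⟨ht, htT⟩)
  have hd := intervalIntegral.integral_hasDerivAt_right hi2 hm hca
  have hr := (Real.hasDerivAt_rpow_const (p := (1:ℝ)/3) (Or.inl ht.ne'))
  refine (((hr.const_mul a).const_add s).sub (hd.const_mul c)).congr_of_eventuallyEq ?_
  filter_upwards [hO.mem_nhds ⟨ht, htT⟩] with u hu
  have := he u (hsub hu)
  rw [← intervalIntegral.integral_of_le hu.1.le] at this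
  simp only [Pi.sub_apply]
  linarith

lemma barrier_top {c a s : ℝ} (hc0 : 0 < c) {f : ℝ → ℝ}
    (hc : ContinuousOn f (barrierDomain ⊤)) (hp : ∀ t ∈ barrierDomain ⊤, 0 < f t)
    (he : ∀ t ∈ barrierDomain ⊤, f t + c * (∫ u in Set.Ioc (0:ℝ) t, ((f u) ^ 2)⁻¹)
      = s + a * t ^ ((1:ℝ)/3)) : Tendsto f atTop atTop := by
  have hmem : ∀ t : ℝ, 0 ≤ t → t ∈ barrierDomain ⊤ := fun t ht => ⟨ht, EReal.coe_lt_top t⟩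
  by_contra hnt
  rw [tendsto_atTop] at hnt
  push Not at hnt
  obtain ⟨M, hM⟩ := hnt
  have hdec : Tendsto (fun t : ℝ => a * ((1:ℝ)/3 * t ^ ((1:ℝ)/3 - 1))) atTop (nhds 0) := by
    have := ((tendsto_rpow_neg_atTop (y := 2/3) (by norm_num)).const_mul ((1:ℝ)/3)).const_mul a
    simp only [mul_zero] at this
    convert this using 5
    norm_num
  -- positivity of M
  have hMpos : 0 < M := by
    obtain ⟨t, h1, h2⟩ := (hM.and_eventually (eventually_ge_atTop 0)).exists
    exact (hp t (hmem t h2)).trans h1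
  set k := c * (M ^ 2)⁻¹ / 2 with hk
  have hkpos : 0 < k := by positivity
  obtain ⟨N, hN⟩ := eventually_atTop.1 (hdec.eventually (gt_mem_nhds hkpos))
  obtain ⟨t0, h1, h2⟩ := (hM.and_eventually (eventually_ge_atTop (max N 1))).exists
  have hN0 : N ≤ t0 := (le_max_left _ _).trans h2
  have h10 : 1 ≤ t0 := (le_max_right _ _).trans h2
  set b := t0 + M / k with hb
  have hbt : t0 ≤ b := by
    have : 0 < M / k := by positivity
    linarith
  have key := image_le_of_deriv_right_lt_deriv_boundary (f := f)
    (f' := fun t => a * ((1:ℝ)/3 * t ^ ((1:ℝ)/3 - 1)) - c * ((f t) ^ 2)⁻¹) (a := t0) (b := b)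
    (B := fun t => M - k * (t - t0)) (B' := fun _ => - k)
    (hc.mono fun u hu => hmem u (by linarith [hu.1]))
    (fun x hx => (barrier_hasDerivAt hc hp he x (by linarith [hx.1])
      (EReal.coe_lt_top x)).hasDerivWithinAt)
    (by simpa using h1.le)
    (fun x => by
      have := (((hasDerivAt_id x).sub_const t0).const_mul k).const_sub M
      simpa using this)
    (by
      intro x hx hfx
      have hx1 := hN x (hN0.trans hx.1)
      have hfp := hp x (hmem x (by linarith [hx.1]))
      have hfM : f x ≤ M := by
        rw [hfx]
        nlinarith [hx.1]
      have : (M ^ 2)⁻¹ ≤ ((f x) ^ 2)⁻¹ := by gcongr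
      have : c * (M ^ 2)⁻¹ ≤ c * ((f x) ^ 2)⁻¹ := by gcongr
      linarith) (right_mem_Icc.2 hbt)
  have hfb := hp b (hmem b (by linarith))
  have : k * (b - t0) = M := by rw [hb]; field_simp; ring
  linarith

lemma barrier_finite {c a s : ℝ} (hc0 : 0 < c) (ha : 0 < a) (hs : 0 < s) {T : ℝ} (hT : 0 < T)
    {f : ℝ → ℝ}
    (hc : ContinuousOn f (barrierDomain T)) (hp : ∀ t ∈ barrierDomain T, 0 < f t)
    (he : ∀ t ∈ barrierDomain T, f t + c * (∫ u in Set.Ioc (0:ℝ) t, ((f u) ^ 2)⁻¹)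
      = s + a * t ^ ((1:ℝ)/3)) :
    ∃ L, 0 ≤ L ∧ Tendsto f (nhdsWithin T (Iio T)) (nhds L) := by
  have hmem : ∀ t : ℝ, 0 ≤ t → t < T → t ∈ barrierDomain T :=
    fun t ht h => ⟨ht, EReal.coe_lt_coe_iff.2 h⟩
  have hi := barrier_inv_cont hc hp
  set F : ℝ → ℝ := fun t => ∫ u in Set.Ioc (0:ℝ) t, ((f u) ^ 2)⁻¹ with hF
  have hmono : MonotoneOn F (Ioo 0 T) := by
    intro x hx y hy hxy
    apply setIntegral_mono_set
    · have : IntegrableOn (fun u => ((f u) ^ 2)⁻¹) (Icc 0 y) :=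
        (hi.mono fun u hu => hmem u hu.1 (lt_of_le_of_lt hu.2 hy.2)).integrableOn_Icc
      exact this.mono_set Ioc_subset_Icc_self
    · exact Eventually.of_forall fun u => by positivity
    · exact (Ioc_subset_Ioc_right hxy).eventuallyLE
  have hbdd : BddAbove (F '' Ioo 0 T) := by
    refine ⟨(s + a * T ^ ((1:ℝ)/3)) / c, ?_⟩
    rintro _ ⟨x, hx, rfl⟩
    rw [le_div_iff₀ hc0]
    have h1 := he x (hmem x hx.1.le hx.2)
    have h2 := hp x (hmem x hx.1.le hx.2)
    have h3 : x ^ ((1:ℝ)/3) ≤ T ^ ((1:ℝ)/3) :=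
      Real.rpow_le_rpow hx.1.le hx.2.le (by norm_num)
    have h4 : a * x ^ ((1:ℝ)/3) ≤ a * T ^ ((1:ℝ)/3) := by gcongr
    have : c * F x = F x * c := mul_comm _ _
    simp only [hF] at this ⊢
    linarith
  have hlim := hmono.tendsto_nhdsWithin_Ioo_left (nonempty_Ioo.2 hT) hbdd
  have hr : Tendsto (fun t : ℝ => s + a * t ^ ((1:ℝ)/3)) (nhdsWithin T (Iio T))
      (nhds (s + a * T ^ ((1:ℝ)/3))) := by
    apply Tendsto.mono_left _ nhdsWithin_le_nhds
    exact (((Real.continuousAt_rpow_const T ((1:ℝ)/3) (Or.inl hT.ne')).tendsto).const_mul a).const_add s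
  have hev : ∀ᶠ t in nhdsWithin T (Iio T), t ∈ Ioo 0 T := Ioo_mem_nhdsLT hT
  have hfl : Tendsto f (nhdsWithin T (Iio T)) (nhds (s + a * T ^ ((1:ℝ)/3) - c * sSup (F '' Ioo 0 T))) := by
    refine (hr.sub (hlim.const_mul c)).congr' ?_
    filter_upwards [hev] with t ht
    have := he t (hmem t ht.1.le ht.2)
    simp only [hF]
    linarith
  refine ⟨_, ?_, hfl⟩
  apply ge_of_tendsto hfl
  filter_upwards [hev] with t ht
  exact (hp t (hmem t ht.1.le ht.2)).le

lemma barrier_extend {c a s : ℝ} {T : ℝ} (hT : 0 < T)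
    {f : ℝ → ℝ}
    (hc : ContinuousOn f (barrierDomain T)) (hp : ∀ t ∈ barrierDomain T, 0 < f t)
    (he : ∀ t ∈ barrierDomain T, f t + c * (∫ u in Set.Ioc (0:ℝ) t, ((f u) ^ 2)⁻¹)
      = s + a * t ^ ((1:ℝ)/3)) {L : ℝ} (hL : 0 < L)
    (hlim : Tendsto f (nhdsWithin T (Iio T)) (nhds L)) :
    ∃ T' : ℝ, T < T' ∧ ∃ g : ℝ → ℝ, (∀ t < T, g t = f t) ∧
      ContinuousOn g (barrierDomain T') ∧ (∀ t ∈ barrierDomain T', 0 < g t) ∧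
      (∀ t ∈ barrierDomain T', g t + c * (∫ u in Set.Ioc (0:ℝ) t, ((g u) ^ 2)⁻¹)
        = s + a * t ^ ((1:ℝ)/3)) := by
  have hmem : ∀ t : ℝ, 0 ≤ t → t < T → t ∈ barrierDomain T :=
    fun t ht h => ⟨ht, EReal.coe_lt_coe_iff.2 h⟩
  obtain ⟨ε, hε, y, hyT, hy⟩ := barrier_local_existence c a T L hT hL
  let g : ℝ → ℝ := fun t => if t < T then f t else y t
  have gl : ∀ t < T, g t = f t := fun t ht => if_pos ht
  have gr : ∀ t, T ≤ t → g t = y t := fun t ht => if_neg (not_lt.2 ht)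
  have hdom : ∀ t ∈ barrierDomain (T + ε : ℝ), 0 ≤ t ∧ t < T + ε :=
    fun t ht => ⟨ht.1, EReal.coe_lt_coe_iff.1 ht.2⟩
  have hym : ∀ t, T ≤ t → t < T + ε → t ∈ Ioo (T - ε) (T + ε) :=
    fun t h1 h2 => ⟨by linarith, h2⟩
  have gp : ∀ t ∈ barrierDomain (T + ε : ℝ), 0 < g t := by
    intro t ht
    obtain ⟨h1, h2⟩ := hdom t ht
    rcases lt_or_ge t T with h | h
    · rw [gl t h]; exact hp t (hmem t h1 h)
    · rw [gr t h]; exact (hy t (hym t h h2)).1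
  have gc : ContinuousOn g (barrierDomain (T + ε : ℝ)) := by
    intro t ht
    obtain ⟨h1, h2⟩ := hdom t ht
    rcases lt_trichotomy t T with h | h | h
    · have hn : barrierDomain T ∈ nhdsWithin t (barrierDomain (T + ε : ℝ)) := by
        filter_upwards [self_mem_nhdsWithin, mem_nhdsWithin_of_mem_nhds (Iio_mem_nhds h)] with u h1 h2
        exact hmem u h1.1 h2
      have := (hc t (hmem t h1 h)).mono_of_mem_nhdsWithin hn
      refine this.congr_of_eventuallyEq ?_ (gl t h)
      filter_upwards [mem_nhdsWithin_of_mem_nhds (Iio_mem_nhds h)] with u h2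
      exact gl u h2
    · subst h
      apply ContinuousAt.continuousWithinAt
      rw [continuousAt_iff_continuous_left'_right']
      constructor
      · have : Tendsto g (nhdsWithin t (Iio t)) (nhds (g t)) := by
          rw [gr t le_rfl, hyT]
          refine hlim.congr' ?_
          filter_upwards [self_mem_nhdsWithin] with u hu
          exact (gl u hu).symm
        exact this
      · have := (hy t (hym t le_rfl h2)).2.continuousAt.continuousWithinAt (s := Ioi t)
        exact this.congr (fun u hu => gr u (le_of_lt hu)) (gr t le_rfl)
    · apply ContinuousAt.continuousWithinAt
      refine (hy t (hym t h.le h2)).2.continuousAt.congr ?_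
      filter_upwards [Ioi_mem_nhds h] with u hu
      exact (gr u (le_of_lt hu)).symm
  have gi := barrier_inv_cont gc gp
  have hsubI : ∀ t, t < T + ε → Icc 0 t ⊆ barrierDomain (T + ε : ℝ) :=
    fun t ht u hu => ⟨hu.1, EReal.coe_lt_coe_iff.2 (lt_of_le_of_lt hu.2 ht)⟩
  have elt : ∀ t, 0 ≤ t → t < T → g t + c * (∫ u in Set.Ioc (0:ℝ) t, ((g u) ^ 2)⁻¹)
        = s + a * t ^ ((1:ℝ)/3) := by
    intro t h1 h2
    rw [gl t h2, ← he t (hmem t h1 h2)]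
    congr 2
    apply setIntegral_congr_fun measurableSet_Ioc
    intro u hu
    simp only
    rw [gl u (lt_of_le_of_lt hu.2 h2)]
  have eT : g T + c * (∫ u in Set.Ioc (0:ℝ) T, ((g u) ^ 2)⁻¹) = s + a * T ^ ((1:ℝ)/3) := by
    have hTe : T < T + ε := by linarith
    have hpc := intervalIntegral.continuousOn_primitive
      ((gi.mono (hsubI T hTe)).integrableOn_Icc (μ := volume))
    have c1 : ContinuousWithinAt (fun t => g t + c * (∫ u in Set.Ioc (0:ℝ) t, ((g u) ^ 2)⁻¹))
        (Icc 0 T) T :=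
      ((gc.mono (hsubI T hTe)) T (right_mem_Icc.2 hT.le)).add
        ((hpc T (right_mem_Icc.2 hT.le)).const_mul c)
    have hsub : nhdsWithin T (Iio T) ≤ nhdsWithin T (Icc 0 T) := by
      rw [← nhdsWithin_Ico_eq_nhdsLT hT]
      exact nhdsWithin_mono _ Ico_subset_Icc_self
    have hr : Tendsto (fun t : ℝ => s + a * t ^ ((1:ℝ)/3)) (nhdsWithin T (Iio T))
        (nhds (s + a * T ^ ((1:ℝ)/3))) := by
      apply Tendsto.mono_left _ nhdsWithin_le_nhds
      exact (((Real.continuousAt_rpow_const T ((1:ℝ)/3)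
        (Or.inl hT.ne')).tendsto).const_mul a).const_add s
    refine tendsto_nhds_unique (c1.tendsto.mono_left hsub) (hr.congr' ?_)
    filter_upwards [Ioo_mem_nhdsLT hT] with t ht
    exact (elt t ht.1.le ht.2).symm
  refine ⟨T + ε, by linarith, g, gl, gc, gp, ?_⟩
  intro t ht
  obtain ⟨h1, h2⟩ := hdom t ht
  rcases lt_or_ge t T with h | h
  · exact elt t h1 h
  have i1 : IntervalIntegrable (fun u => ((g u) ^ 2)⁻¹) volume 0 T :=
    (gi.mono (hsubI T (by linarith))).intervalIntegrable_of_Icc hT.le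
  have i2 : IntervalIntegrable (fun u => ((g u) ^ 2)⁻¹) volume T t :=
    (gi.mono ((Icc_subset_Icc_left hT.le).trans (hsubI t h2))).intervalIntegrable_of_Icc h
  have hadd := intervalIntegral.integral_add_adjacent_intervals i1 i2
  rw [intervalIntegral.integral_of_le hT.le, intervalIntegral.integral_of_le h1] at hadd
  have hftc : ∫ u in T..t, - (c * ((g u) ^ 2)⁻¹) =
      (y t - a * t ^ ((1:ℝ)/3)) - (y T - a * T ^ ((1:ℝ)/3)) := by
    refine intervalIntegral.integral_eq_sub_of_hasDerivAt
      (f := fun t => y t - a * t ^ ((1:ℝ)/3)) ?_ (i2.const_mul c).neg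
    intro x hx
    rw [uIcc_of_le h] at hx
    have d1 := (hy x (hym x hx.1 (lt_of_le_of_lt hx.2 h2))).2
    have hr := (Real.hasDerivAt_rpow_const (p := (1:ℝ)/3) (Or.inl (hT.trans_le hx.1).ne'))
    have := d1.sub (hr.const_mul a)
    rw [gr x hx.1]
    have e : ∀ p q : ℝ, - q = p - q - p := fun p q => by ring
    rw [e (a * ((1:ℝ)/3 * x ^ ((1:ℝ)/3 - 1)))]
    exact this
  rw [intervalIntegral.integral_neg, intervalIntegral.integral_const_mul] at hftc
  rw [← hadd, gr t h]
  rw [gr T le_rfl] at eT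
  linarith

/-- Dichotomy for maximal solutions of the barrier equation: either `T = ∞` and
`f(t) → ∞` as `t → ∞`, or `T < ∞` and `f(t) → 0` as `t → T⁻`. -/
theorem barrier_solution_dichotomy
    (σ a s : ℝ) (hσ : 0 < σ) (ha : 0 < a) (hs : 0 < s)
    (T : EReal) (hT : 0 < T) (f : ℝ → ℝ)
    (hf : IsBarrierSolution σ a s T f)
    (hmax : ¬ ∃ T' : EReal, T < T' ∧ ∃ g : ℝ → ℝ,
      IsBarrierSolution σ a s T' g ∧ ∀ t ∈ barrierDomain T, g t = f t) :
    (T = ⊤ ∧ Filter.Tendsto f Filter.atTop Filter.atTop) ∨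
    (T ≠ ⊤ ∧ Filter.Tendsto f (nhdsWithin T.toReal (Set.Iio T.toReal)) (nhds 0)) := by
  have hc0 : 0 < Real.pi ^ 2 * σ ^ 2 / 2 := by
    have := Real.pi_pos
    positivity
  obtain ⟨hc, hp, he⟩ := hf
  induction T with
  | bot => simp at hT
  | top => exact Or.inl ⟨rfl, barrier_top hc0 hc hp he⟩
  | coe T =>
    have hT' : 0 < T := by exact_mod_cast hT
    refine Or.inr ⟨EReal.coe_ne_top T, ?_⟩
    rw [EReal.toReal_coe]
    obtain ⟨L, hL, hlim⟩ := barrier_finite hc0 ha hs hT' hc hp he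
    rcases hL.eq_or_lt with h | h
    · rwa [← h] at hlim
    · exfalso
      obtain ⟨T', hTT, g, hg, h1, h2, h3⟩ := barrier_extend hT' hc hp he h hlim
      exact hmax ⟨T', EReal.coe_lt_coe_iff.2 hTT, g, ⟨h1, h2, h3⟩,
        fun t ht => hg t (EReal.coe_lt_coe_iff.1 ht.2)⟩
end

section
/- Supercritical asymptotics: assume a > a_c and let b be the unique real with b > 2a_c/3 and a = b + 3π²σ²/(2b²). Then there exists a solution of the barrier equation with parameter a and initial value 1 on [0, ∞), and every solution f : [0, ∞) → (0, ∞) of the barrier equation with parameter a and initial value 1 satisfies f(t)/t^{1/3} → b as t → ∞. -/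
open MeasureTheory Filter Set

lemma global_ode (v : ℝ → ℝ → ℝ) (K L : NNReal) (x₀ : ℝ)
    (hv : ∀ t, LipschitzWith K (v t)) (hc : ∀ x, Continuous (fun t => v t x))
    (hL : ∀ t x, ‖v t x‖ ≤ L) :
    ∃ F : ℝ → ℝ, F 0 = x₀ ∧ ∀ t, HasDerivAt F (v t (F t)) t := by
  have key : ∀ n : ℕ, ∃ α : ℝ → ℝ, α 0 = x₀ ∧
      ∀ t ∈ Ioo (-((n:ℝ)+1)) ((n:ℝ)+1), HasDerivAt α (v t (α t)) t := by
    intro n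
    have hn : (0:ℝ) ≤ (n:ℝ) := Nat.cast_nonneg n
    have h0 : (0:ℝ) ∈ Icc (-((n:ℝ)+1)) ((n:ℝ)+1) := ⟨by linarith, by linarith⟩
    have hp : IsPicardLindelof v (⟨0, h0⟩ : Icc (-((n:ℝ)+1)) ((n:ℝ)+1)) x₀
        (L * ((n:NNReal)+1)) 0 L K := by
      refine ⟨fun t _ => (hv t).lipschitzOnWith, fun x _ => (hc x).continuousOn,
        fun t _ x _ => hL t x, ?_⟩
      simp
    obtain ⟨α, h1, h2⟩ := hp.exists_eq_forall_mem_Icc_hasDerivWithinAt₀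
    refine ⟨α, h1, fun t ht => ?_⟩
    exact (h2 t (Ioo_subset_Icc_self ht)).hasDerivAt (Icc_mem_nhds ht.1 ht.2)
  choose α hα0 hα using key
  have cons : ∀ n m : ℕ, n ≤ m → EqOn (α n) (α m) (Ioo (-((n:ℝ)+1)) ((n:ℝ)+1)) := by
    intro n m hnm
    have hn : (0:ℝ) ≤ (n:ℝ) := Nat.cast_nonneg n
    have hnm' : (n:ℝ) ≤ m := by exact_mod_cast hnm
    refine ODE_solution_unique_of_mem_Ioo (v := v) (s := fun _ => univ) (K := K) (t₀ := 0)
      (fun t _ => (hv t).lipschitzOnWith) ⟨by linarith, by linarith⟩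
      (fun t ht => ⟨hα n t ht, trivial⟩)
      (fun t ht => ⟨hα m t ⟨by linarith [ht.1], by linarith [ht.2]⟩, trivial⟩) ?_
    rw [hα0, hα0]
  have hF : ∀ n : ℕ, EqOn (fun t => α ⌈|t|⌉₊ t) (α n) (Ioo (-((n:ℝ)+1)) ((n:ℝ)+1)) := by
    intro n t ht
    rcases le_total n ⌈|t|⌉₊ with h | h
    · exact (cons _ _ h ht).symm
    · refine cons _ _ h ?_
      have h1 := Nat.le_ceil |t|
      have h2 := abs_le.1 h1
      exact ⟨by linarith [h2.1], by linarith [h2.2]⟩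
  refine ⟨fun t => α ⌈|t|⌉₊ t, by simp [hα0], fun t => ?_⟩
  have h1 := Nat.le_ceil |t|
  have h2 := abs_le.1 h1
  have hm : t ∈ Ioo (-((⌈|t|⌉₊:ℝ)+1)) ((⌈|t|⌉₊:ℝ)+1) :=
    ⟨by linarith [h2.1], by linarith [h2.2]⟩
  exact (hα _ t hm).congr_of_eventuallyEq
    ((hF ⌈|t|⌉₊).eventuallyEq_of_mem (Ioo_mem_nhds hm.1 hm.2))

lemma exists_F (k a b : ℝ) (hk : 0 < k) (hb : 0 < b) (hab : a = b + 3 * k / b ^ 2) :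
    ∃ F : ℝ → ℝ, Continuous F ∧ F 0 = 1 ∧ (∀ t, 0 ≤ t → 1 ≤ F t) ∧
      ∀ t, 0 < t → HasDerivAt F (a - 3 * k * t ^ 2 / F t ^ 2) t := by
  set m : ℝ → ℝ → ℝ := fun t x => max x (b * |t| + 1) with hm
  have m1 : ∀ t x, 1 ≤ m t x := fun t x =>
    le_trans (by have := abs_nonneg t; nlinarith) (le_max_right _ _)
  have m2 : ∀ t x, b * |t| ≤ m t x := fun t x =>
    le_trans (by linarith) (le_max_right _ _)
  have r0 : ∀ t x, 0 ≤ |t| / m t x := fun t x =>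
    div_nonneg (abs_nonneg t) (by linarith [m1 t x])
  have r1 : ∀ t x, |t| / m t x ≤ 1 / b := fun t x => by
    rw [div_le_div_iff₀ (by linarith [m1 t x]) hb]; linarith [m2 t x]
  have r2 : ∀ t x, (|t| / m t x) ^ 2 ≤ 1 / b ^ 2 := fun t x => by
    have := pow_le_pow_left₀ (r0 t x) (r1 t x) 2
    rwa [one_div_pow] at this
  set v : ℝ → ℝ → ℝ := fun t x => a - 3 * k * (|t| / m t x) ^ 2 with hv
  have vb : ∀ t x, b ≤ v t x := fun t x => by
    have h := mul_le_mul_of_nonneg_left (r2 t x) (by positivity : 0 ≤ 3 * k)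
    have : 3 * k * (1 / b ^ 2) = 3 * k / b ^ 2 := by ring
    simp only [hv]; linarith
  have va : ∀ t x, v t x ≤ a := fun t x => by
    have : 0 ≤ 3 * k * (|t| / m t x) ^ 2 := by positivity
    simp only [hv]; linarith
  have ha : 0 < a := by rw [hab]; positivity
  have hlip : ∀ t, LipschitzWith (Real.toNNReal (6 * k / b ^ 2)) (v t) := by
    intro t
    refine LipschitzWith.of_dist_le_mul fun x y => ?_
    rw [Real.coe_toNNReal _ (by positivity), Real.dist_eq, Real.dist_eq]
    have e1 : v t x - v t y = 3 * k * ((|t| / m t y + |t| / m t x) * (|t| / m t y - |t| / m t x)) := by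
      simp only [hv]; ring
    have px := m1 t x
    have py := m1 t y
    have px0 : m t x ≠ 0 := by linarith
    have py0 : m t y ≠ 0 := by linarith
    have e2 : |t| / m t y - |t| / m t x = (|t| / m t y) * ((m t x - m t y) * (1 / m t x)) := by
      field_simp
    have e3 : |m t x - m t y| ≤ |x - y| := by
      simpa [hm] using abs_max_sub_max_le_abs x y (b * |t| + 1)
    have e4 : |1 / m t x| ≤ 1 := by
      rw [abs_of_nonneg (by positivity)]
      rw [div_le_one (by linarith)]; exact px
    have e5 : |(m t x - m t y) * (1 / m t x)| ≤ |x - y| := by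
      rw [abs_mul]
      calc _ ≤ |x - y| * 1 := mul_le_mul e3 e4 (abs_nonneg _) (abs_nonneg _)
        _ = _ := mul_one _
    rw [e1, e2, abs_mul (3 * k), abs_mul (|t| / m t y + |t| / m t x), abs_mul (|t| / m t y), abs_of_nonneg (by positivity : 0 ≤ 3 * k),
      abs_of_nonneg (add_nonneg (r0 t y) (r0 t x)), abs_of_nonneg (r0 t y)]
    calc 3 * k * ((|t| / m t y + |t| / m t x) * (|t| / m t y * |(m t x - m t y) * (1 / m t x)|))
        ≤ 3 * k * ((1 / b + 1 / b) * (1 / b * |x - y|)) := by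
          refine mul_le_mul_of_nonneg_left ?_ (by positivity)
          exact mul_le_mul (add_le_add (r1 t y) (r1 t x))
            (mul_le_mul (r1 t y) e5 (abs_nonneg _) (by positivity))
            (mul_nonneg (r0 t y) (abs_nonneg _)) (by positivity)
      _ = _ := by field_simp; ring
  have hcont : ∀ x, Continuous (fun t => v t x) := by
    intro x
    simp only [hv, hm]
    refine continuous_const.sub (continuous_const.mul (Continuous.pow (Continuous.div ?_ ?_ ?_) 2))
    · fun_prop
    · fun_prop
    · intro t; have := m1 t x; simp only [hm] at this; linarith
  obtain ⟨F, hF0, hF⟩ := global_ode v _ (Real.toNNReal a) 1 hlip hcont (fun t x => by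
    rw [Real.coe_toNNReal _ ha.le, Real.norm_eq_abs, abs_of_nonneg (by linarith [vb t x])]
    exact va t x)
  have hmono : Monotone (fun t => F t - b * t) := by
    refine monotone_of_hasDerivAt_nonneg (f' := fun t => v t (F t) - b) (fun t => ?_) ?_
    · exact ((hF t).sub ((hasDerivAt_id t).const_mul b)).congr_deriv (by ring)
    · intro t; have := vb t (F t); simp only [Pi.zero_apply]; linarith
  have hlow : ∀ t, 0 ≤ t → b * t + 1 ≤ F t := by
    intro t ht
    have := hmono ht
    simp only [hF0] at this
    linarith
  refine ⟨F, continuous_iff_continuousAt.2 fun t => (hF t).continuousAt, hF0, fun t ht => ?_,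
    fun t ht => ?_⟩
  · have := hlow t ht; nlinarith
  · have h := hF t
    have e : m t (F t) = F t := by
      simp only [hm, abs_of_pos ht]; exact max_eq_left (hlow t ht.le)
    have e' : v t (F t) = a - 3 * k * t ^ 2 / F t ^ 2 := by
      simp only [hv, e, div_pow, sq_abs]; ring
    rwa [e'] at h

lemma hasDeriv_int (f : ℝ → ℝ) (hf : Continuous f) (hp : ∀ t, 0 < f t) (τ : ℝ) :
    HasDerivAt (fun τ : ℝ => ∫ u in (0:ℝ)..(τ ^ 3), ((f u) ^ 2)⁻¹)
      (((f (τ ^ 3)) ^ 2)⁻¹ * (3 * τ ^ 2)) τ := by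
  have hc : Continuous (fun u => ((f u) ^ 2)⁻¹) :=
    (hf.pow 2).inv₀ (fun t => pow_ne_zero 2 (hp t).ne')
  have h1 := (hc.integral_hasStrictDerivAt 0 (τ ^ 3)).hasDerivAt
  have h2 : HasDerivAt (fun τ : ℝ => τ ^ 3) (3 * τ ^ 2) τ := by simpa using hasDerivAt_pow 3 τ
  exact HasDerivAt.comp (h₂ := fun x => ∫ u in (0:ℝ)..x, ((f u) ^ 2)⁻¹) (h := fun τ : ℝ => τ ^ 3) τ h1 h2

lemma cube_root (t : ℝ) (ht : 0 ≤ t) : (t ^ ((1:ℝ)/3)) ^ 3 = t := by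
  rw [← Real.rpow_natCast, ← Real.rpow_mul ht]; norm_num

lemma root_cube (t : ℝ) (ht : 0 ≤ t) : (t ^ 3) ^ ((1:ℝ)/3) = t := by
  rw [← Real.rpow_natCast, ← Real.rpow_mul ht]; norm_num

lemma exists_sol (σ a b : ℝ) (hσ : 0 < σ) (hb : 0 < b)
    (hab : a = b + 3 * (Real.pi ^ 2 * σ ^ 2 / 2) / b ^ 2) :
    ∃ f : ℝ → ℝ, IsBarrierSolution σ a 1 ⊤ f := by
  have hpi := Real.pi_pos
  set k := Real.pi ^ 2 * σ ^ 2 / 2 with hk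
  have hk0 : 0 < k := by positivity
  obtain ⟨F, hFc, hF0, hF1, hF⟩ := exists_F k a b hk0 hb hab
  have hroot : Continuous (fun t : ℝ => t ^ ((1:ℝ)/3)) := Real.continuous_rpow_const (by norm_num)
  set f : ℝ → ℝ := fun t => F |t ^ ((1:ℝ)/3)| with hf
  have hfc : Continuous f := hFc.comp hroot.abs
  have hfp : ∀ t, 0 < f t := fun t => by
    have := hF1 _ (abs_nonneg (t ^ ((1:ℝ)/3))); simp only [hf]; linarith
  have hfr : ∀ τ, 0 ≤ τ → f (τ ^ 3) = F τ := fun τ hτ => by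
    simp only [hf, root_cube τ hτ, abs_of_nonneg hτ]
  refine ⟨f, hfc.continuousOn, fun t _ => hfp t, fun t ht => ?_⟩
  have ht0 : 0 ≤ t := ht.1
  set H : ℝ → ℝ := fun τ => F τ + k * (∫ u in (0:ℝ)..(τ ^ 3), ((f u) ^ 2)⁻¹) - a * τ with hH
  have hHc : Continuous H := by
    have h1 : Continuous (fun τ : ℝ => ∫ u in (0:ℝ)..(τ ^ 3), ((f u) ^ 2)⁻¹) :=
      continuous_iff_continuousAt.2 fun τ => (hasDeriv_int f hfc hfp τ).continuousAt
    fun_prop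
  have hHd : ∀ τ, 0 < τ → HasDerivAt H 0 τ := by
    intro τ hτ
    have h := ((hF τ hτ).add ((hasDeriv_int f hfc hfp τ).const_mul k)).sub
      ((hasDerivAt_id τ).const_mul a)
    refine h.congr_deriv ?_
    rw [hfr τ hτ.le]
    have : F τ ≠ 0 := by have := hF1 τ hτ.le; linarith
    field_simp
    ring
  have hmono : MonotoneOn H (Ici 0) := monotoneOn_of_hasDerivWithinAt_nonneg (f' := fun _ => 0)
    (convex_Ici 0) hHc.continuousOn (fun x hx => by
      rw [interior_Ici] at hx; exact (hHd x hx).hasDerivWithinAt) (fun _ _ => le_rfl)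
  have hanti : AntitoneOn H (Ici 0) := antitoneOn_of_hasDerivWithinAt_nonpos (f' := fun _ => 0)
    (convex_Ici 0) hHc.continuousOn (fun x hx => by
      rw [interior_Ici] at hx; exact (hHd x hx).hasDerivWithinAt) (fun _ _ => le_rfl)
  have hr0 : 0 ≤ t ^ ((1:ℝ)/3) := Real.rpow_nonneg ht0 _
  have e : H (t ^ ((1:ℝ)/3)) = H 0 :=
    le_antisymm (hanti self_mem_Ici hr0 hr0) (hmono self_mem_Ici hr0 hr0)
  simp only [hH, cube_root t ht0, hF0] at e
  rw [← hfr _ hr0, cube_root t ht0] at e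
  rw [← intervalIntegral.integral_of_le ht0]
  have e0 : (0:ℝ) ^ 3 = 0 := by norm_num
  rw [e0, intervalIntegral.integral_same] at e
  rw [← hk]
  linarith

lemma asymp (k a b : ℝ) (hk : 0 < k) (hb : 0 < b) (hab : a = b + 3 * k / b ^ 2)
    (hkb : 6 * k < b ^ 3) (F : ℝ → ℝ) (hFc : Continuous F) (hF0 : F 0 = 1)
    (hF : ∀ t, 0 < t → HasDerivAt F (a - 3 * k * t ^ 2 / F t ^ 2) t) :
    Tendsto (fun t => F t / t) atTop (nhds b) := by
  have hD' : ∀ t, 0 < t → HasDerivAt (fun t => F t - b * t)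
      (3 * k / b ^ 2 - 3 * k * t ^ 2 / F t ^ 2) t := by
    intro t ht
    have h := (hF t ht).sub ((hasDerivAt_id t).const_mul b)
    refine h.congr_deriv ?_
    rw [hab]; ring
  have hDc : Continuous (fun t => F t - b * t) := by fun_prop
  have hpos : ∀ t, 0 ≤ t → 0 < F t - b * t := by
    by_contra! hcon
    obtain ⟨t1, ht1, hneg⟩ := hcon
    set S : Set ℝ := {t | 0 ≤ t ∧ F t - b * t ≤ 0} with hS
    have hSc : IsClosed S := (isClosed_le continuous_const continuous_id).inter
      (isClosed_le hDc continuous_const)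
    have hSb : BddBelow S := ⟨0, fun t ht => ht.1⟩
    have hmem := hSc.csInf_mem ⟨t1, ht1, hneg⟩ hSb
    set t0 := sInf S with ht0
    have hmono : MonotoneOn (fun t => F t - b * t) (Icc 0 t0) := by
      refine monotoneOn_of_hasDerivWithinAt_nonneg
        (f' := fun t => 3 * k / b ^ 2 - 3 * k * t ^ 2 / F t ^ 2)
        (convex_Icc 0 t0) hDc.continuousOn (fun x hx => ?_) (fun x hx => ?_)
      · rw [interior_Icc] at hx
        exact (hD' x hx.1).hasDerivWithinAt
      · rw [interior_Icc] at hx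
        have hx2 : 0 < F x - b * x := by
          by_contra! hc
          exact absurd (csInf_le hSb (show x ∈ S from ⟨hx.1.le, hc⟩)) (not_le.2 hx.2)
        have hx1 := hx.1
        have h3 : 0 < b * x := by positivity
        have h4 : (b * x) ^ 2 ≤ F x ^ 2 := pow_le_pow_left₀ h3.le (by linarith) 2
        have h5 : 0 < F x := by linarith
        rw [sub_nonneg, div_le_div_iff₀ (by positivity) (by positivity)]
        nlinarith
    have := hmono (left_mem_Icc.2 hmem.1) (right_mem_Icc.2 hmem.1) hmem.1
    simp only [hF0] at this
    linarith [hmem.2]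
  set p : ℝ := 6 * k / b ^ 3 with hp
  have hp1 : p < 1 := by rw [hp, div_lt_one (by positivity)]; exact hkb
  have hanti : AntitoneOn (fun t => (F t - b * t) * t ^ (-p)) (Ici 1) := by
    have hd : ∀ t, 0 < t → HasDerivAt (fun t => (F t - b * t) * t ^ (-p))
        ((3 * k / b ^ 2 - 3 * k * t ^ 2 / F t ^ 2) * t ^ (-p) +
          (F t - b * t) * (-p * t ^ (-p - 1))) t := fun t ht =>
      (hD' t ht).mul (Real.hasDerivAt_rpow_const (Or.inl ht.ne'))
    refine antitoneOn_of_hasDerivWithinAt_nonpos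
      (f' := fun t => (3 * k / b ^ 2 - 3 * k * t ^ 2 / F t ^ 2) * t ^ (-p) +
          (F t - b * t) * (-p * t ^ (-p - 1)))
      (convex_Ici 1) (fun t ht => ?_) (fun t ht => ?_) (fun t ht => ?_)
    · exact (hd t (lt_of_lt_of_le one_pos ht)).continuousAt.continuousWithinAt
    · rw [interior_Ici] at ht
      exact (hd t (lt_trans one_pos ht)).hasDerivWithinAt
    · rw [interior_Ici] at ht
      have ht0 : 0 < t := lt_trans one_pos ht
      have hD := hpos t ht0.le
      have hbt : 0 < b * t := by positivity
      have hFp : 0 < F t := by linarith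
      rw [Real.rpow_sub_one ht0.ne']
      have e : (3 * k / b ^ 2 - 3 * k * t ^ 2 / F t ^ 2) * t ^ (-p) +
          (F t - b * t) * (-p * (t ^ (-p) / t)) =
          -(t ^ (-p) * (3 * k) * (F t - b * t) / (b ^ 3 * t * F t ^ 2)) *
            (2 * F t ^ 2 - b * t * (F t + b * t)) := by
        rw [hp]; field_simp; ring
      rw [e]
      refine mul_nonpos_of_nonpos_of_nonneg (neg_nonpos.2 ?_) ?_
      · positivity
      · nlinarith
  set C := F 1 - b * 1 with hC
  have hbound : ∀ t, 1 ≤ t → F t - b * t ≤ C * t ^ p := by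
    intro t ht
    have h := hanti self_mem_Ici ht ht
    have ht0 : 0 < t := by linarith
    simp only [Real.one_rpow, mul_one, Real.rpow_neg ht0.le] at h
    have h2 : 0 < t ^ p := Real.rpow_pos_of_pos ht0 p
    rw [← div_eq_mul_inv, div_le_iff₀ h2] at h
    simpa [hC] using h
  have hlim : Tendsto (fun t : ℝ => b + C * t ^ (-(1 - p))) atTop (nhds b) := by
    simpa using ((tendsto_rpow_neg_atTop (by linarith : 0 < 1 - p)).const_mul C).const_add b
  refine tendsto_of_tendsto_of_tendsto_of_le_of_le' tendsto_const_nhds hlim ?_ ?_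
  · filter_upwards [eventually_ge_atTop 1] with t ht
    have ht0 : 0 < t := by linarith
    rw [le_div_iff₀ ht0]; linarith [hpos t ht0.le]
  · filter_upwards [eventually_ge_atTop 1] with t ht
    have ht0 : 0 < t := by linarith
    rw [div_le_iff₀ ht0, show -(1 - p) = p - 1 by ring, Real.rpow_sub_one ht0.ne']
    have := hbound t ht
    have e : (b + C * (t ^ p / t)) * t = b * t + C * t ^ p := by field_simp
    rw [e]; linarith

/-- Supercritical asymptotics: if `a > a_c` and `b > 2a_c/3` satisfies
`a = b + 3π²σ²/(2b²)`, then a global solution with initial value `1` exists and every such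
solution satisfies `f(t)/t^{1/3} → b`. -/
theorem barrier_solution_supercritical
    (σ a : ℝ) (hσ : 0 < σ) (ha : aCrit σ < a)
    (b : ℝ) (hb : 2 * aCrit σ / 3 < b)
    (hab : a = b + 3 * Real.pi ^ 2 * σ ^ 2 / (2 * b ^ 2)) :
    (∃ f : ℝ → ℝ, IsBarrierSolution σ a 1 ⊤ f) ∧
    ∀ f : ℝ → ℝ, IsBarrierSolution σ a 1 ⊤ f →
      Filter.Tendsto (fun t : ℝ => f t / t ^ ((1:ℝ)/3)) Filter.atTop (nhds b) := by
  have hpi := Real.pi_pos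
  set c : ℝ := 3 * Real.pi ^ 2 * σ ^ 2 with hc
  have hc0 : 0 < c := by positivity
  have hr : 0 < c ^ ((1:ℝ)/3) := Real.rpow_pos_of_pos hc0 _
  have hbr : c ^ ((1:ℝ)/3) < b := by
    have : 2 * aCrit σ / 3 = c ^ ((1:ℝ)/3) := by simp only [aCrit, ← hc]; ring
    rwa [this] at hb
  have hb0 : 0 < b := hr.trans hbr
  have hkb : c < b ^ 3 := by
    have h := pow_lt_pow_left₀ hbr hr.le (by norm_num : (3:ℕ) ≠ 0)
    rwa [cube_root c hc0.le] at h
  have hab' : a = b + 3 * (Real.pi ^ 2 * σ ^ 2 / 2) / b ^ 2 := by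
    rw [hab, hc]; field_simp
  refine ⟨exists_sol σ a b hσ hb0 hab', fun f hf => ?_⟩
  obtain ⟨hfc, hfp, hfe⟩ := hf
  have hdom : ∀ t : ℝ, 0 ≤ t → t ∈ barrierDomain ⊤ := fun t ht => ⟨ht, EReal.coe_lt_top t⟩
  set g : ℝ → ℝ := fun t => f |t| with hg
  have hgc : Continuous g :=
    hfc.comp_continuous continuous_abs (fun t => hdom _ (abs_nonneg t))
  have hgp : ∀ t, 0 < g t := fun t => hfp _ (hdom _ (abs_nonneg t))
  have hgf : ∀ t, 0 ≤ t → g t = f t := fun t ht => by simp only [hg, abs_of_nonneg ht]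
  have hge : ∀ τ, 0 ≤ τ → g (τ ^ 3) = 1 + a * τ - Real.pi ^ 2 * σ ^ 2 / 2 *
      (∫ u in (0:ℝ)..(τ ^ 3), ((g u) ^ 2)⁻¹) := by
    intro τ hτ
    have h3 : 0 ≤ τ ^ 3 := by positivity
    have h := hfe _ (hdom _ h3)
    rw [root_cube τ hτ] at h
    rw [hgf _ h3, intervalIntegral.integral_of_le h3,
      setIntegral_congr_fun measurableSet_Ioc
        (fun u hu => by simp only [hgf u hu.1.le] : EqOn (fun u => ((g u) ^ 2)⁻¹)
          (fun u => ((f u) ^ 2)⁻¹) (Ioc 0 (τ ^ 3)))]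
    linarith
  have hlim := asymp (Real.pi ^ 2 * σ ^ 2 / 2) a b (by positivity) hb0 hab'
    (by rw [hc] at hkb; linarith) (fun τ => g (τ ^ 3)) (by fun_prop)
    (by have := hge 0 le_rfl; simpa using this) (fun τ hτ => by
      have h := ((hasDerivAt_id τ).const_mul a).const_add 1 |>.sub
        ((hasDeriv_int g hgc hgp τ).const_mul (Real.pi ^ 2 * σ ^ 2 / 2))
      have h2 : (fun τ => g (τ ^ 3)) =ᶠ[nhds τ] fun τ => 1 + a * τ - Real.pi ^ 2 * σ ^ 2 / 2 *
          (∫ u in (0:ℝ)..(τ ^ 3), ((g u) ^ 2)⁻¹) := by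
        filter_upwards [Ioi_mem_nhds hτ] with x hx using hge x (le_of_lt hx)
      refine (HasDerivAt.congr_of_eventuallyEq ?_ h2)
      refine h.congr_deriv ?_
      have := (hgp (τ ^ 3)).ne'
      field_simp)
  have hroot : Tendsto (fun t : ℝ => t ^ ((1:ℝ)/3)) atTop atTop :=
    tendsto_rpow_atTop (by norm_num)
  refine (hlim.comp hroot).congr' ?_
  filter_upwards [eventually_ge_atTop 0] with t ht
  simp only [Function.comp, cube_root t ht, hgf t ht]
end

section
/- Critical asymptotics: assume a = a_c. Then there exists a solution of the barrier equation with parameter a_c and initial value 1 on [0, ∞), and every solution f : [0, ∞) → (0, ∞) of the barrier equation with parameter a_c and initial value 1 satisfies f(t)/t^{1/3} → 2a_c/3 as t → ∞. -/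
open MeasureTheory Filter Set

noncomputable def bV (y : ℝ) : ℝ := Real.exp (2 * y / 3 - 1 / 9 * Real.log (1 + 3 * y / 2))

noncomputable def bU (y : ℝ) : ℝ := y * bV |y|

lemma bV_pos (y : ℝ) : 0 < bV y := Real.exp_pos _

lemma bV_one_le {y : ℝ} (hy : 0 ≤ y) : 1 ≤ bV y := by
  unfold bV
  apply Real.one_le_exp
  have := Real.log_le_sub_one_of_pos (show 0 < 1 + 3 * y / 2 by linarith)
  linarith

lemma bV_hasDerivAt {y : ℝ} (hy : 0 ≤ y) :
    HasDerivAt bV (bV y * ((1 + 2 * y) / (2 + 3 * y))) y := by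
  have h1 : HasDerivAt (fun y : ℝ => 1 + 3 * y / 2) (3 / 2) y := by
    simpa using (((hasDerivAt_id y).const_mul 3).div_const 2).const_add 1
  have h2 := h1.log (by positivity)
  have h3 : HasDerivAt (fun y : ℝ => 2 * y / 3) (2 / 3) y := by
    simpa using (((hasDerivAt_id y).const_mul 2).div_const 3)
  have h4 := (h3.sub (h2.const_mul (1 / 9))).exp
  convert h4 using 1
  unfold bV
  simp only [Pi.sub_apply]
  congr 1
  have : (2 + 3 * y) ≠ 0 := by positivity
  have : (1 + 3 * y / 2) ≠ 0 := by positivity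
  field_simp
  ring

lemma bVabs_cont : Continuous (fun y : ℝ => bV |y|) := by
  rw [continuous_iff_continuousAt]
  intro y
  exact ContinuousAt.comp (g := bV) (f := fun y : ℝ => |y|)
    (bV_hasDerivAt (abs_nonneg y)).continuousAt continuous_abs.continuousAt

lemma bU_cont : Continuous bU := continuous_id.mul bVabs_cont

lemma bU_hasDerivAt {y : ℝ} (hy : 0 < y) :
    HasDerivAt bU (bV y * (2 * (1 + y) ^ 2 / (2 + 3 * y))) y := by
  have h := (hasDerivAt_id y).mul (bV_hasDerivAt hy.le)
  have h2 : bU =ᶠ[nhds y] (id * bV) := by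
    filter_upwards [lt_mem_nhds hy] with z hz
    simp [bU, abs_of_pos hz]
  refine (h.congr_of_eventuallyEq h2).congr_deriv ?_
  have : (2 + 3 * y) ≠ 0 := by positivity
  simp only [id]
  field_simp
  ring

lemma bU_strictMono : StrictMono bU := by
  apply strictMono_of_odd_strictMonoOn_nonneg
  · intro x; simp [bU]
  · apply strictMonoOn_of_deriv_pos (convex_Ici 0) bU_cont.continuousOn
    intro x hx
    rw [interior_Ici] at hx
    have hx : 0 < x := hx
    rw [(bU_hasDerivAt hx).deriv]
    have := bV_pos x
    positivity

lemma bU_surj : Function.Surjective bU := by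
  apply bU_cont.surjective
  · refine tendsto_atTop_mono' _ ?_ tendsto_id
    filter_upwards [eventually_ge_atTop 0] with y hy
    have := bV_one_le (abs_nonneg y)
    simp only [bU, id]; nlinarith
  · refine tendsto_atBot_mono' _ ?_ tendsto_id
    filter_upwards [eventually_le_atBot 0] with y hy
    have := bV_one_le (abs_nonneg y)
    simp only [bU, id]; nlinarith

noncomputable def bI : ℝ ≃o ℝ := StrictMono.orderIsoOfSurjective bU bU_strictMono bU_surj

noncomputable def bY (r : ℝ) : ℝ := bI.symm r

lemma bU_bY (r : ℝ) : bU (bY r) = r := bI.apply_symm_apply r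

lemma bY_cont : Continuous bY := bI.symm.continuous

lemma bY_zero : bY 0 = 0 := by
  apply bU_strictMono.injective
  rw [bU_bY]; simp [bU]

lemma bY_strictMono : StrictMono bY := bI.symm.strictMono

lemma bY_pos {r : ℝ} (hr : 0 < r) : 0 < bY r := by
  rw [← bY_zero]; exact bY_strictMono hr

lemma bY_nonneg {r : ℝ} (hr : 0 ≤ r) : 0 ≤ bY r := by
  rw [← bY_zero]; exact bY_strictMono.monotone hr

lemma bY_hasDerivAt {r : ℝ} (hr : 0 < r) :
    HasDerivAt bY (bV (bY r) * (2 * (1 + bY r) ^ 2 / (2 + 3 * bY r)))⁻¹ r := by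
  have hp := bY_pos hr
  have := bV_pos (bY r)
  exact HasDerivAt.of_local_left_inverse bY_cont.continuousAt (bU_hasDerivAt hp)
    (by positivity) (Eventually.of_forall bU_bY)

lemma bY_tendsto : Tendsto bY atTop atTop := bI.symm.tendsto_atTop

noncomputable def bF (y : ℝ) : ℝ := bV |y| * (1 + y)

lemma bF_cont : Continuous bF := bVabs_cont.mul (continuous_const.add continuous_id)

lemma bF_hasDerivAt {y : ℝ} (hy : 0 < y) :
    HasDerivAt bF (bV y * ((3 + 6 * y + 2 * y ^ 2) / (2 + 3 * y))) y := by
  have h := (bV_hasDerivAt hy.le).mul ((hasDerivAt_id y).const_add 1)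
  have h2 : bF =ᶠ[nhds y] (bV * (fun y => 1 + id y)) := by
    filter_upwards [lt_mem_nhds hy] with z hz
    simp [bF, abs_of_pos hz]
  refine (h.congr_of_eventuallyEq h2).congr_deriv ?_
  have : (2 + 3 * y) ≠ 0 := by positivity
  simp only [id]
  field_simp
  ring

noncomputable def bSol (b t : ℝ) : ℝ := bF (bY (b * t ^ ((1:ℝ)/3)))

lemma cbrt_cont : Continuous (fun t : ℝ => t ^ ((1:ℝ)/3)) :=
  Real.continuous_rpow_const (by norm_num)

lemma bSol_cont (b : ℝ) : Continuous (bSol b) :=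
  bF_cont.comp (bY_cont.comp (continuous_const.mul cbrt_cont))

lemma bSol_pos {b t : ℝ} (hb : 0 < b) (ht : 0 ≤ t) : 0 < bSol b t := by
  have := bY_nonneg (show 0 ≤ b * t ^ ((1:ℝ)/3) by positivity)
  have := bV_pos |bY (b * t ^ ((1:ℝ)/3))|
  unfold bSol bF
  positivity

lemma bSol_zero (b : ℝ) : bSol b 0 = 1 := by
  simp [bSol, bY_zero, bF, bV]

lemma bSol_hasDerivAt {b t : ℝ} (hb : 0 < b) (ht : 0 < t) :
    HasDerivAt (fun t => bSol b t - 3 / 2 * b * t ^ ((1:ℝ)/3))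
      (-(b ^ 3 / 6) * ((bSol b t) ^ 2)⁻¹) t := by
  have hr : 0 < t ^ ((1:ℝ)/3) := by positivity
  have hd : HasDerivAt (fun t : ℝ => t ^ ((1:ℝ)/3)) (1 / 3 * ((t ^ ((1:ℝ)/3)) ^ 2)⁻¹) t := by
    have := Real.hasDerivAt_rpow_const (x := t) (p := (1:ℝ)/3) (Or.inl ht.ne')
    convert this using 1
    congr 1
    rw [← Real.rpow_natCast, ← Real.rpow_mul ht.le, ← Real.rpow_neg ht.le]
    norm_num
  have hY := bY_pos (show 0 < b * t ^ ((1:ℝ)/3) by positivity)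
  have h1 := (bY_hasDerivAt (show 0 < b * t ^ ((1:ℝ)/3) by positivity)).comp t (hd.const_mul b)
  have h2 := (bF_hasDerivAt hY).comp t h1
  have h3 := h2.sub (hd.const_mul (3 / 2 * b))
  refine h3.congr_deriv ?_
  have hU := bU_bY (b * t ^ ((1:ℝ)/3))
  unfold bSol bF
  unfold bU at hU
  rw [abs_of_pos hY] at hU ⊢
  generalize bY (b * t ^ ((1:ℝ)/3)) = y at *
  generalize t ^ ((1:ℝ)/3) = r at *
  have hV := bV_pos y
  generalize bV y = V at *
  obtain rfl : r = y * V / b := by field_simp; linarith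
  have : (2 + 3 * y) ≠ 0 := by positivity
  have : (1 + y) ≠ 0 := by positivity
  field_simp
  ring

lemma bSol_eq {b t : ℝ} (hb : 0 < b) (ht : 0 ≤ t) :
    bSol b t + b ^ 3 / 6 * (∫ u in Set.Ioc (0:ℝ) t, ((bSol b u) ^ 2)⁻¹)
      = 1 + 3 / 2 * b * t ^ ((1:ℝ)/3) := by
  have hc : ContinuousOn (fun u => -(b ^ 3 / 6) * ((bSol b u) ^ 2)⁻¹) (Icc 0 t) := by
    refine continuousOn_const.mul (ContinuousOn.inv₀ ((bSol_cont b).pow 2).continuousOn ?_)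
    intro u hu
    exact (pow_pos (bSol_pos hb hu.1) 2).ne'
  have h := intervalIntegral.integral_eq_sub_of_hasDerivAt_of_le ht
    (f := fun t => bSol b t - 3 / 2 * b * t ^ ((1:ℝ)/3))
    (f' := fun u => -(b ^ 3 / 6) * ((bSol b u) ^ 2)⁻¹)
    ((bSol_cont b).sub (continuous_const.mul cbrt_cont)).continuousOn
    (fun u hu => bSol_hasDerivAt hb hu.1)
    (ContinuousOn.intervalIntegrable (by rwa [uIcc_of_le ht]))
  rw [intervalIntegral.integral_const_mul, intervalIntegral.integral_of_le ht] at h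
  simp only [bSol_zero] at h
  rw [Real.zero_rpow (by norm_num)] at h
  linarith

lemma bSol_tendsto {b : ℝ} (hb : 0 < b) :
    Tendsto (fun t : ℝ => bSol b t / t ^ ((1:ℝ)/3)) atTop (nhds b) := by
  have h1 : Tendsto (fun t : ℝ => bY (b * t ^ ((1:ℝ)/3))) atTop atTop :=
    bY_tendsto.comp ((tendsto_rpow_atTop (by norm_num)).const_mul_atTop hb)
  have h2 : Tendsto (fun t : ℝ => b * (1 + (bY (b * t ^ ((1:ℝ)/3)))⁻¹)) atTop (nhds b) := by
    simpa using ((tendsto_inv_atTop_zero.comp h1).const_add 1).const_mul b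
  refine h2.congr' ?_
  filter_upwards [eventually_gt_atTop 0] with t ht
  have hr : 0 < t ^ ((1:ℝ)/3) := by positivity
  have hY := bY_pos (show 0 < b * t ^ ((1:ℝ)/3) by positivity)
  have hU := bU_bY (b * t ^ ((1:ℝ)/3))
  unfold bSol bF
  unfold bU at hU
  rw [abs_of_pos hY] at hU ⊢
  generalize bY (b * t ^ ((1:ℝ)/3)) = y at *
  generalize t ^ ((1:ℝ)/3) = r at *
  have hV := bV_pos y
  generalize bV y = V at *
  obtain rfl : r = y * V / b := by field_simp; linarith
  field_simp
  ring

lemma mem_dom_top (t : ℝ) : t ∈ barrierDomain ⊤ ↔ 0 ≤ t := by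
  simp [barrierDomain]

lemma barrier_ext {σ a s : ℝ} {f : ℝ → ℝ} (hf : IsBarrierSolution σ a s ⊤ f) :
    ∃ F : ℝ → ℝ, Continuous F ∧ (∀ t, 0 < F t) ∧ (∀ t, 0 ≤ t → F t = f t) ∧
      ∀ t, 0 ≤ t → F t = s + a * t ^ ((1:ℝ)/3)
        - Real.pi ^ 2 * σ ^ 2 / 2 * ∫ u in (0:ℝ)..t, ((F u) ^ 2)⁻¹ := by
  obtain ⟨h1, h2, h3⟩ := hf
  have hF : ∀ t, 0 ≤ t → f (max t 0) = f t := fun t ht => by rw [max_eq_left ht]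
  refine ⟨fun t => f (max t 0), ?_, ?_, hF, ?_⟩
  · exact h1.comp_continuous (by fun_prop) (fun t => by simp [mem_dom_top])
  · intro t; exact h2 _ (by simp [mem_dom_top])
  · intro t ht
    have := h3 t (by simpa [mem_dom_top] using ht)
    rw [intervalIntegral.integral_of_le ht]
    have e : ∫ u in Ioc 0 t, ((f (max u 0)) ^ 2)⁻¹ = ∫ u in Ioc 0 t, ((f u) ^ 2)⁻¹ := by
      apply setIntegral_congr_fun measurableSet_Ioc
      intro u hu
      simp only [hF u hu.1.le]
    simp only [hF t ht, e]
    linarith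

lemma barrier_unique {σ a s : ℝ} {f g : ℝ → ℝ} (hf : IsBarrierSolution σ a s ⊤ f)
    (hg : IsBarrierSolution σ a s ⊤ g) {T : ℝ} (hT : 0 ≤ T) : f T = g T := by
  obtain ⟨F, hFc, hFp, hFe, hF⟩ := barrier_ext hf
  obtain ⟨G, hGc, hGp, hGe, hG⟩ := barrier_ext hg
  rw [← hFe T hT, ← hGe T hT]
  obtain ⟨x, -, hx⟩ := isCompact_Icc.exists_isMinOn (nonempty_Icc.2 hT)
    (hFc.min hGc).continuousOn
  set m := min (F x) (G x) with hm
  have hm0 : 0 < m := lt_min (hFp x) (hGp x)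
  have hmF : ∀ t ∈ Icc 0 T, m ≤ F t := fun t ht => (hx ht).trans (min_le_left _ _)
  have hmG : ∀ t ∈ Icc 0 T, m ≤ G t := fun t ht => (hx ht).trans (min_le_right _ _)
  set c := Real.pi ^ 2 * σ ^ 2 / 2 with hc
  have hc0 : 0 ≤ c := by positivity
  have cF : Continuous (fun u => ((F u) ^ 2)⁻¹) :=
    (hFc.pow 2).inv₀ (fun u => (pow_pos (hFp u) 2).ne')
  have cG : Continuous (fun u => ((G u) ^ 2)⁻¹) :=
    (hGc.pow 2).inv₀ (fun u => (pow_pos (hGp u) 2).ne')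
  have hder : ∀ t ∈ Ico 0 T, HasDerivWithinAt (fun t => F t - G t)
      (c * ((G t ^ 2)⁻¹ - (F t ^ 2)⁻¹)) (Ici t) t := by
    intro t ht
    have d1 := (cG.integral_hasStrictDerivAt 0 t).hasDerivAt
    have d2 := (cF.integral_hasStrictDerivAt 0 t).hasDerivAt
    refine ((d1.sub d2).const_mul c).hasDerivWithinAt.congr ?_ ?_
    · intro u hu
      have hu0 : 0 ≤ u := ht.1.trans hu
      simp only [Pi.sub_apply]
      linarith [hF u hu0, hG u hu0]
    · simp only [Pi.sub_apply]
      linarith [hF t ht.1, hG t ht.1]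
  have key := norm_le_gronwallBound_of_norm_deriv_right_le (f := fun t => F t - G t) (δ := 0) (K := c * (2 / m ^ 3)) (ε := 0)
    (hFc.sub hGc).continuousOn hder ?_ ?_ T ⟨hT, le_rfl⟩
  · rw [gronwallBound_ε0_δ0] at key
    have := norm_le_zero_iff.1 key
    exact sub_eq_zero.1 this
  · have h1 := hF 0 le_rfl
    have h2 := hG 0 le_rfl
    simp at h1 h2
    simp [h1, h2]
  · intro t ht
    have ht' := Ico_subset_Icc_self ht
    have p := hmF t ht'
    have q := hmG t ht'
    have hp := hFp t
    have hq := hGp t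
    generalize F t = p' at *
    generalize G t = q' at *
    have e : (q' ^ 2)⁻¹ - (p' ^ 2)⁻¹ = (1 / (q' ^ 2 * p') + 1 / (q' * p' ^ 2)) * (p' - q') := by
      field_simp
      ring
    rw [add_zero, norm_mul, Real.norm_of_nonneg hc0, mul_assoc, e, norm_mul]
    have a1 : 1 / (q' ^ 2 * p') ≤ 1 / (m ^ 2 * m) := by gcongr
    have a2 : 1 / (q' * p' ^ 2) ≤ 1 / (m * m ^ 2) := by gcongr
    have a3 : 1 / (m ^ 2 * m) + 1 / (m * m ^ 2) = 2 / m ^ 3 := by field_simp; norm_num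
    rw [Real.norm_of_nonneg (show 0 ≤ 1 / (q' ^ 2 * p') + 1 / (q' * p' ^ 2) by positivity)]
    gcongr
    linarith

/-- Critical asymptotics: for `a = a_c`, a global solution with initial value `1` exists and
every such solution satisfies `f(t)/t^{1/3} → 2a_c/3`. -/
theorem barrier_solution_critical
    (σ : ℝ) (hσ : 0 < σ) :
    (∃ f : ℝ → ℝ, IsBarrierSolution σ (aCrit σ) 1 ⊤ f) ∧
    ∀ f : ℝ → ℝ, IsBarrierSolution σ (aCrit σ) 1 ⊤ f →
      Filter.Tendsto (fun t : ℝ => f t / t ^ ((1:ℝ)/3)) Filter.atTop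
        (nhds (2 * aCrit σ / 3)) := by
  obtain ⟨b, hbdef⟩ : ∃ b, b = (3 * Real.pi ^ 2 * σ ^ 2) ^ ((1:ℝ)/3) := ⟨_, rfl⟩
  have hpi := Real.pi_pos
  have hb : 0 < b := by rw [hbdef]; positivity
  have ha : aCrit σ = 3 / 2 * b := by rw [hbdef]; rfl
  have hb3 : b ^ 3 = 3 * Real.pi ^ 2 * σ ^ 2 := by
    rw [hbdef, ← Real.rpow_natCast, ← Real.rpow_mul (by positivity)]
    norm_num
  have hsol : IsBarrierSolution σ (aCrit σ) 1 ⊤ (bSol b) := by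
    refine ⟨(bSol_cont b).continuousOn, fun t ht => bSol_pos hb ht.1, fun t ht => ?_⟩
    rw [ha, ← bSol_eq hb ht.1, hb3]
    ring
  refine ⟨⟨_, hsol⟩, fun f hf => ?_⟩
  have e : 2 * aCrit σ / 3 = b := by rw [ha]; ring
  rw [e]
  refine (bSol_tendsto hb).congr' ?_
  filter_upwards [eventually_ge_atTop 0] with t ht
  rw [barrier_unique hf hsol ht]
end

section
/- Subcritical blow-down: assume a < a_c. Then there is no solution of the barrier equation with parameter a and initial value 1 on [0, ∞); consequently every maximal solution f : [0, T) → (0, ∞) of the barrier equation with parameter a and initial value 1 has T < ∞ and satisfies f(t) → 0 as t → T⁻. -/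
open MeasureTheory Filter Set

lemma bs_amgm (B g : ℝ) (hB : 0 < B) (hg : 0 < g) :
    3 / 2 * B ≤ g + B ^ 3 / 2 * (g ^ 2)⁻¹ := by
  have h : g + B ^ 3 / 2 * (g ^ 2)⁻¹ - 3 / 2 * B
      = (g - B) ^ 2 * (2 * g + B) / (2 * g ^ 2) := by
    field_simp
    ring
  have h2 : 0 ≤ (g - B) ^ 2 * (2 * g + B) / (2 * g ^ 2) := by positivity
  linarith

lemma bs_cont_inv (f : ℝ → ℝ) (hf : Continuous f) (hp : ∀ t, 0 < f t) :
    Continuous (fun u => ((f u) ^ 2)⁻¹) :=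
  (hf.pow 2).inv₀ (fun t => (pow_pos (hp t) 2).ne')

lemma bs_no_global (σ a : ℝ) (hσ : 0 < σ) (hac : a < aCrit σ) (f : ℝ → ℝ)
    (hf : IsBarrierSolution σ a 1 ⊤ f) : False := by
  obtain ⟨hc, hp, he⟩ := hf
  have hdom : ∀ t : ℝ, 0 ≤ t → t ∈ barrierDomain ⊤ := fun t ht => ⟨ht, EReal.coe_lt_top t⟩
  set F : ℝ → ℝ := fun t => f (max t 0) with hF
  have hFc : Continuous F := by
    apply hc.comp_continuous (by fun_prop)
    intro t
    exact hdom _ (le_max_right _ _)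
  have hFp : ∀ t, 0 < F t := fun t => hp _ (hdom _ (le_max_right _ _))
  have hic := bs_cont_inv F hFc hFp
  set c := Real.pi ^ 2 * σ ^ 2 / 2 with hcdef
  have hcpos : 0 < c := by positivity
  have hFe : ∀ t, 0 ≤ t → F t + c * (∫ u in (0:ℝ)..t, ((F u) ^ 2)⁻¹)
      = 1 + a * t ^ ((1:ℝ)/3) := by
    intro t ht
    rw [intervalIntegral.integral_of_le ht, ← he t (hdom t ht)]
    have h1 : F t = f t := by simp [hF, ht]
    rw [h1]
    congr 2
    apply setIntegral_congr_fun measurableSet_Ioc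
    intro u hu
    simp [hF, hu.1.le]
  obtain ⟨B, hB, hB3, hBc⟩ : ∃ B : ℝ, 0 < B ∧ B ^ 3 = 6 * c ∧ aCrit σ = 3 / 2 * B := by
    refine ⟨(3 * Real.pi ^ 2 * σ ^ 2) ^ ((1:ℝ)/3), by positivity, ?_, rfl⟩
    rw [← Real.rpow_natCast, ← Real.rpow_mul (by positivity)]
    norm_num
    rw [hcdef]; ring
  have hexp : ∀ x : ℝ, (Real.exp (3 * x)) ^ ((1:ℝ)/3) = Real.exp x := by
    intro x
    rw [← Real.exp_mul]
    congr 1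
    ring
  have hFx : ∀ x, F (Real.exp (3 * x)) =
      1 + a * Real.exp x - c * (∫ u in (0:ℝ)..(Real.exp (3 * x)), ((F u) ^ 2)⁻¹) := by
    intro x
    have := hFe (Real.exp (3 * x)) (Real.exp_pos _).le
    rw [hexp] at this
    linarith
  set δ := aCrit σ - a with hδ
  have hδp : 0 < δ := by linarith
  set g : ℝ → ℝ := fun x => F (Real.exp (3 * x)) * Real.exp (-x) with hg
  have hgp : ∀ x, 0 < g x := fun x => mul_pos (hFp _) (Real.exp_pos _)
  have hgd : ∀ x, HasDerivAt g (a - 3 * c * ((g x) ^ 2)⁻¹ - g x) x := by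
    intro x
    have e3 : HasDerivAt (fun x : ℝ => Real.exp (3 * x)) (Real.exp (3 * x) * 3) x := by
      have := ((hasDerivAt_id x).const_mul 3).exp
      simpa using this
    have em : HasDerivAt (fun x : ℝ => Real.exp (-x)) (Real.exp (-x) * (-1)) x := by
      have := ((hasDerivAt_id x).neg).exp
      simpa using this
    have hP : HasDerivAt (fun u => ∫ v in (0:ℝ)..u, ((F v) ^ 2)⁻¹)
        ((F (Real.exp (3 * x)) ^ 2)⁻¹) (Real.exp (3 * x)) :=
      (hic.integral_hasStrictDerivAt 0 _).hasDerivAt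
    have hPc := HasDerivAt.comp x hP e3
    have h1 : HasDerivAt (fun x => F (Real.exp (3 * x)))
        (a * Real.exp x - c * ((F (Real.exp (3 * x)) ^ 2)⁻¹ * (Real.exp (3 * x) * 3))) x := by
      have h2 := (((Real.hasDerivAt_exp x).const_mul a).const_add 1).sub (hPc.const_mul c)
      refine h2.congr_of_eventuallyEq (Eventually.of_forall fun y => ?_)
      simpa using hFx y
    have h3 := h1.mul em
    refine h3.congr_deriv ?_
    have hE := Real.exp_pos x
    have hFpos := hFp (Real.exp (3 * x))
    have hn : Real.exp (-x) = (Real.exp x)⁻¹ := Real.exp_neg x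
    have h3x : Real.exp (3 * x) = Real.exp x ^ 3 := by
      rw [← Real.exp_nat_mul]; norm_num
    simp only [hg]
    generalize F (Real.exp (3 * x)) = y at *
    rw [hn, h3x]
    field_simp
    ring
  have hanti : Antitone (fun x => g x + δ * x) := by
    have hd : ∀ x, HasDerivAt (fun x => g x + δ * x)
        (a - 3 * c * ((g x) ^ 2)⁻¹ - g x + δ) x := by
      intro x
      have := (hgd x).add ((hasDerivAt_id x).const_mul δ)
      refine (this.congr_deriv ?_)
      ring
    apply antitone_of_deriv_nonpos (fun x => (hd x).differentiableAt)
    intro x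
    rw [(hd x).deriv]
    have := bs_amgm B (g x) hB (hgp x)
    rw [hB3] at this
    have e : 6 * c / 2 = 3 * c := by ring
    rw [e] at this
    linarith
  have h0 : (0:ℝ) ≤ g 0 / δ := (div_pos (hgp 0) hδp).le
  have h1 := hanti h0
  simp only [mul_zero, add_zero] at h1
  rw [mul_div_cancel₀ _ hδp.ne'] at h1
  linarith [hgp (g 0 / δ)]

lemma bs_local (a c T L : ℝ) (hT : 0 < T) (hL : 0 < L) :
    ∃ ε > 0, ∃ y : ℝ → ℝ, y T = L ∧ ∀ t ∈ Icc T (T + ε), 0 < y t ∧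
      HasDerivAt y (a * ((1:ℝ)/3 * t ^ ((1:ℝ)/3 - 1)) - c * ((y t) ^ 2)⁻¹) t := by
  set v : ℝ × ℝ → ℝ × ℝ := fun p =>
    (1, a * ((1:ℝ)/3 * p.1 ^ ((1:ℝ)/3 - 1)) - c * (p.2 ^ 2)⁻¹) with hv
  have hcd : ContDiffAt ℝ 1 v (T, L) := by
    apply ContDiffAt.prodMk contDiffAt_const
    apply ContDiffAt.sub
    · apply contDiffAt_const.mul
      apply contDiffAt_const.mul
      exact contDiffAt_fst.rpow_const_of_ne hT.ne'
    · apply contDiffAt_const.mul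
      exact (contDiffAt_snd.pow 2).inv (pow_pos hL 2).ne'
  obtain ⟨α, hα0, ε, hε, hα⟩ :=
    hcd.exists_forall_mem_closedBall_exists_eq_forall_mem_Ioo_hasDerivAt₀ T
  have hfst : ∀ t ∈ Ioo (T - ε) (T + ε), HasDerivAt (fun t => (α t).1) 1 t := fun t ht =>
    (hasFDerivAt_fst (𝕜 := ℝ) (p := α t)).comp_hasDerivAt t (hα t ht)
  have hsnd : ∀ t ∈ Ioo (T - ε) (T + ε), HasDerivAt (fun t => (α t).2)
      (a * ((1:ℝ)/3 * (α t).1 ^ ((1:ℝ)/3 - 1)) - c * ((α t).2 ^ 2)⁻¹) t := fun t ht =>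
    (hasFDerivAt_snd (𝕜 := ℝ) (p := α t)).comp_hasDerivAt t (hα t ht)
  have hTmem : T ∈ Ioo (T - ε) (T + ε) := ⟨by linarith, by linarith⟩
  have hpos : ∀ᶠ t in nhds T, 0 < (α t).2 := by
    have := (hsnd T hTmem).continuousAt
    apply this.eventually_const_lt
    simpa [hα0] using hL
  obtain ⟨η, hη, hpos⟩ := Metric.eventually_nhds_iff.1 hpos
  refine ⟨min (ε / 2) (η / 2), by positivity, fun t => (α t).2, by simp [hα0], ?_⟩
  intro t ht
  have h1 := min_le_left (ε / 2) (η / 2)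
  have h2 := min_le_right (ε / 2) (η / 2)
  have htm : t ∈ Ioo (T - ε) (T + ε) := ⟨by linarith [ht.1], by linarith [ht.2]⟩
  have key : ∀ x ∈ Icc T t, (α x).1 - x = (α T).1 - T := by
    have hd : ∀ x ∈ Icc T t, HasDerivAt (fun x => (α x).1 - x) 0 x := by
      intro x hx
      have := (hfst x ⟨by linarith [hx.1], by linarith [hx.2, htm.2]⟩).sub (hasDerivAt_id x)
      exact this.congr_deriv (sub_self 1)
    apply constant_of_has_deriv_right_zero (f := fun x => (α x).1 - x)
    · exact fun x hx => (hd x hx).continuousAt.continuousWithinAt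
    · exact fun x hx => (hd x (Ico_subset_Icc_self hx)).hasDerivWithinAt
  have hk := key t ⟨ht.1, le_rfl⟩
  have hk2 : (α t).1 = t := by
    rw [hα0] at hk
    simp only [sub_self] at hk
    linarith
  constructor
  · apply hpos
    rw [Real.dist_eq, abs_lt]
    constructor <;> linarith [ht.1, ht.2]
  · have := hsnd t htm
    rwa [hk2] at this

lemma bs_extend (σ a T L : ℝ) (hT : 0 < T) (hL : 0 < L) (f : ℝ → ℝ)
    (hf : IsBarrierSolution σ a 1 (T : EReal) f)
    (hlim : Tendsto f (nhdsWithin T (Iio T)) (nhds L)) :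
    ∃ T' : EReal, (T : EReal) < T' ∧ ∃ g : ℝ → ℝ,
        IsBarrierSolution σ a 1 T' g ∧ ∀ t ∈ barrierDomain (T : EReal), g t = f t := by
  obtain ⟨hc, hp, he⟩ := hf
  have hdom : ∀ t : ℝ, 0 ≤ t → t < T → t ∈ barrierDomain (T : EReal) :=
    fun t ht h => ⟨ht, EReal.coe_lt_coe_iff.2 h⟩
  set c := Real.pi ^ 2 * σ ^ 2 / 2 with hcdef
  obtain ⟨ε, hε, y, hyT, hy⟩ := bs_local a c T L hT hL
  set G : ℝ → ℝ := fun t => if t < T then f (max t 0) else y (min t (T + ε)) with hG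
  have hGf : ∀ t, 0 ≤ t → t < T → G t = f t := by
    intro t h0 h1
    simp [hG, h0, h1]
  have hGy : ∀ t, T ≤ t → t ≤ T + ε → G t = y t := by
    intro t h0 h1
    simp [hG, h0, h1]
  have hGp : ∀ t, 0 < G t := by
    intro t
    simp only [hG]
    split_ifs with h
    · exact hp _ (hdom _ (le_max_right _ _) (max_lt h hT))
    · exact (hy _ ⟨le_min (not_lt.1 h) (by linarith), min_le_right _ _⟩).1
  have hyc : ContinuousOn (fun t => y (min t (T + ε))) (Ici T) := by
    have h1 : ContinuousOn y (Icc T (T + ε)) := fun x hx =>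
      (hy x hx).2.continuousAt.continuousWithinAt
    exact h1.comp (by fun_prop) (fun t ht => ⟨le_min ht (by linarith), min_le_right _ _⟩)
  have hfc : ContinuousOn (fun t => f (max t 0)) (Iio T) :=
    hc.comp (by fun_prop) (fun t ht => hdom _ (le_max_right _ _) (max_lt ht hT))
  have hGc : Continuous G := by
    rw [continuous_iff_continuousAt]
    intro t
    rcases lt_trichotomy t T with h | h | h
    · refine (hfc.continuousAt (Iio_mem_nhds h)).congr ?_
      filter_upwards [Iio_mem_nhds h] with x hx
      simp only [hG]
      rw [if_pos (mem_Iio.1 hx)]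
    · subst h
      have hGt : G t = L := by rw [hGy t le_rfl (by linarith), hyT]
      rw [continuousAt_iff_continuous_left'_right']
      constructor
      · unfold ContinuousWithinAt
        rw [hGt]
        refine hlim.congr' ?_
        filter_upwards [self_mem_nhdsWithin, mem_nhdsWithin_of_mem_nhds (Ioi_mem_nhds hT)]
          with x hx hx0
        exact (hGf x (le_of_lt hx0) hx).symm
      · refine ((hyc t self_mem_Ici).mono Ioi_subset_Ici_self).congr ?_ ?_
        · intro x hx
          simp only [hG]
          rw [if_neg (not_lt.2 (le_of_lt hx))]
        · simp [hG]
    · refine (hyc.continuousAt (Ici_mem_nhds h)).congr ?_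
      filter_upwards [Ioi_mem_nhds h] with x hx
      simp only [hG]
      rw [if_neg (not_lt.2 (le_of_lt hx))]
  have hic := bs_cont_inv G hGc hGp
  set P : ℝ → ℝ := fun t => ∫ u in (0:ℝ)..t, ((G u) ^ 2)⁻¹ with hP
  have hPd : ∀ t, HasDerivAt P ((G t ^ 2)⁻¹) t := fun t =>
    (hic.integral_hasStrictDerivAt 0 t).hasDerivAt
  have hPc : Continuous P := continuous_iff_continuousAt.2 fun t => (hPd t).continuousAt
  set H : ℝ → ℝ := fun t => G t + c * P t - a * t ^ ((1:ℝ)/3) with hH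
  have hrc : Continuous (fun t : ℝ => t ^ ((1:ℝ)/3)) :=
    Real.continuous_rpow_const (by norm_num)
  have hHc : Continuous H := (hGc.add (hPc.const_mul c)).sub (hrc.const_mul a)
  have hH1 : ∀ t, 0 ≤ t → t < T → H t = 1 := by
    intro t h0 h1
    have h2 := he t (hdom t h0 h1)
    have h3 : P t = ∫ u in Set.Ioc (0:ℝ) t, ((f u) ^ 2)⁻¹ := by
      simp only [hP]
      rw [intervalIntegral.integral_of_le h0]
      apply setIntegral_congr_fun measurableSet_Ioc
      intro u hu
      simp only
      rw [hGf u hu.1.le (hu.2.trans_lt h1)]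
    simp only [hH]
    rw [h3, hGf t h0 h1]
    linarith
  have hHT : H T = 1 := by
    have h1 : Tendsto H (nhdsWithin T (Iio T)) (nhds (H T)) :=
      hHc.continuousAt.tendsto.mono_left nhdsWithin_le_nhds
    have h2 : Tendsto H (nhdsWithin T (Iio T)) (nhds 1) := by
      refine tendsto_const_nhds.congr' ?_
      filter_upwards [self_mem_nhdsWithin, mem_nhdsWithin_of_mem_nhds (Ioi_mem_nhds hT)]
          with x hx hx0
      exact (hH1 x (le_of_lt hx0) hx).symm
    exact tendsto_nhds_unique h1 h2
  have hH2 : ∀ t ∈ Icc T (T + ε), H t = H T := by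
    apply constant_of_has_deriv_right_zero hHc.continuousOn
    intro x hx
    have hx0 : 0 < x := hT.trans_le hx.1
    have h1 : HasDerivWithinAt G
        (a * ((1:ℝ)/3 * x ^ ((1:ℝ)/3 - 1)) - c * ((G x) ^ 2)⁻¹) (Ici x) x := by
      rw [hGy x hx.1 hx.2.le]
      refine (hy x (Ico_subset_Icc_self hx)).2.hasDerivWithinAt.congr_of_eventuallyEq ?_
        (hGy x hx.1 hx.2.le)
      filter_upwards [self_mem_nhdsWithin, mem_nhdsWithin_of_mem_nhds (Iio_mem_nhds hx.2)]
        with z hz hz2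
      exact hGy z (hx.1.trans hz) (le_of_lt hz2)
    have h2 := (h1.add ((hPd x).hasDerivWithinAt.const_mul c)).sub
      ((Real.hasDerivAt_rpow_const (p := (1:ℝ)/3) (Or.inl hx0.ne')).hasDerivWithinAt.const_mul a)
    refine h2.congr_deriv ?_
    ring
  refine ⟨((T + ε : ℝ) : EReal), EReal.coe_lt_coe_iff.2 (by linarith), G, ⟨hGc.continuousOn,
    fun t _ => hGp t, ?_⟩, fun t ht => hGf t ht.1 (EReal.coe_lt_coe_iff.1 ht.2)⟩
  intro t ht
  have ht2 : t < T + ε := EReal.coe_lt_coe_iff.1 ht.2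
  have h1 : H t = 1 := by
    rcases lt_or_ge t T with h | h
    · exact hH1 t ht.1 h
    · rw [hH2 t ⟨h, ht2.le⟩, hHT]
  simp only [hH, hP] at h1
  rw [intervalIntegral.integral_of_le ht.1] at h1
  rw [← hcdef]
  linarith

lemma bs_limit (σ a T : ℝ) (hσ : 0 < σ) (ha : 0 < a) (hT : 0 < T) (f : ℝ → ℝ)
    (hf : IsBarrierSolution σ a 1 (T : EReal) f) :
    ∃ L, 0 ≤ L ∧ Tendsto f (nhdsWithin T (Iio T)) (nhds L) := by
  obtain ⟨hc, hp, he⟩ := hf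
  have hdom : ∀ t : ℝ, 0 ≤ t → t < T → t ∈ barrierDomain (T : EReal) :=
    fun t ht h => ⟨ht, EReal.coe_lt_coe_iff.2 h⟩
  set c := Real.pi ^ 2 * σ ^ 2 / 2 with hcdef
  have hcpos : 0 < c := by positivity
  set I : ℝ → ℝ := fun t => ∫ u in Set.Ioc (0:ℝ) t, ((f u) ^ 2)⁻¹ with hI
  have hint : ∀ t ∈ Ioo 0 T, IntegrableOn (fun u => ((f u) ^ 2)⁻¹) (Ioc 0 t) := by
    intro t ht
    have hs : ∀ u ∈ Icc 0 t, u ∈ barrierDomain (T : EReal) := fun u hu =>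
      hdom u hu.1 (hu.2.trans_lt ht.2)
    have : ContinuousOn (fun u => ((f u) ^ 2)⁻¹) (Icc 0 t) :=
      ((hc.mono hs).pow 2).inv₀ (fun u hu => (pow_pos (hp u (hs u hu)) 2).ne')
    exact this.integrableOn_Icc.mono_set Ioc_subset_Icc_self
  have hmono : MonotoneOn I (Ioo 0 T) := by
    intro s hs t ht hst
    apply setIntegral_mono_set (hint t ht)
    · exact Eventually.of_forall fun u => by simp only [Pi.zero_apply]; positivity
    · exact (Ioc_subset_Ioc_right hst).eventuallyLE
  have hbdd : BddAbove (I '' Ioo 0 T) := by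
    refine ⟨(1 + a * T ^ ((1:ℝ)/3)) / c, ?_⟩
    rintro _ ⟨t, ht, rfl⟩
    have h1 := he t (hdom t ht.1.le ht.2)
    have h2 := hp t (hdom t ht.1.le ht.2)
    have h3 : t ^ ((1:ℝ)/3) ≤ T ^ ((1:ℝ)/3) :=
      Real.rpow_le_rpow ht.1.le ht.2.le (by norm_num)
    have h4 := mul_le_mul_of_nonneg_left h3 ha.le
    rw [le_div_iff₀ hcpos]
    simp only [hI]
    linarith
  have hlimI := hmono.tendsto_nhdsWithin_Ioo_left ⟨T / 2, by constructor <;> linarith⟩ hbdd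
  set S := sSup (I '' Ioo 0 T)
  have hrc : Tendsto (fun t : ℝ => t ^ ((1:ℝ)/3)) (nhdsWithin T (Iio T))
      (nhds (T ^ ((1:ℝ)/3))) :=
    (Real.continuous_rpow_const (by norm_num)).continuousAt.tendsto.mono_left nhdsWithin_le_nhds
  have hev : ∀ᶠ t in nhdsWithin T (Iio T), t ∈ Ioo 0 T := Ioo_mem_nhdsLT hT
  have hlim : Tendsto f (nhdsWithin T (Iio T)) (nhds (1 + a * T ^ ((1:ℝ)/3) - c * S)) := by
    refine ((tendsto_const_nhds.add (hrc.const_mul a)).sub (hlimI.const_mul c)).congr' ?_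
    filter_upwards [hev] with t ht
    have h1 := he t (hdom t ht.1.le ht.2)
    simp only [hI]
    linarith
  refine ⟨_, ?_, hlim⟩
  apply ge_of_tendsto hlim
  filter_upwards [hev] with t ht
  exact (hp t (hdom t ht.1.le ht.2)).le

/-- Subcritical blow-down: if `a < a_c` there is no global solution with initial value `1`,
and every maximal solution lives on a finite interval `[0,T)` and tends to `0` at `T⁻`. -/
theorem barrier_solution_subcritical
    (σ a : ℝ) (hσ : 0 < σ) (ha : 0 < a) (hac : a < aCrit σ) :
    (¬ ∃ f : ℝ → ℝ, IsBarrierSolution σ a 1 ⊤ f) ∧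
    ∀ (T : EReal) (f : ℝ → ℝ), 0 < T → IsBarrierSolution σ a 1 T f →
      (¬ ∃ T' : EReal, T < T' ∧ ∃ g : ℝ → ℝ,
        IsBarrierSolution σ a 1 T' g ∧ ∀ t ∈ barrierDomain T, g t = f t) →
      T ≠ ⊤ ∧ Filter.Tendsto f (nhdsWithin T.toReal (Set.Iio T.toReal)) (nhds 0) := by
  refine ⟨fun ⟨f, hf⟩ => bs_no_global σ a hσ hac f hf, ?_⟩
  intro T f hT hf hmax
  have hTt : T ≠ ⊤ := by
    rintro rfl
    exact bs_no_global σ a hσ hac f hf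
  refine ⟨hTt, ?_⟩
  have hTb : T ≠ ⊥ := by
    rintro rfl
    exact not_lt_bot hT
  obtain ⟨r, rfl⟩ : ∃ r : ℝ, T = (r : EReal) := ⟨T.toReal, (EReal.coe_toReal hTt hTb).symm⟩
  rw [EReal.toReal_coe]
  have hr : 0 < r := by exact_mod_cast hT
  obtain ⟨L, hL0, hL⟩ := bs_limit σ a r hσ ha hr f hf
  rcases hL0.eq_or_lt with h | h
  · rw [h]; exact hL
  · exact absurd (bs_extend σ a r L hr h f hf hL) hmax
end

section
/- Improvement of upper growth bounds: let s > 0, b > 0, and let f : [0, ∞) → (0, ∞) be a solution of the barrier equation with parameter a and initial value s on [0, ∞). If limsup_{t→∞} f(t)/t^{1/3} ≤ b, then limsup_{t→∞} f(t)/t^{1/3} ≤ a − 3π²σ²/(2b²). -/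
open MeasureTheory Filter Set

/-- Improvement of upper growth bounds: if a global barrier solution satisfies
`limsup f(t)/t^{1/3} ≤ b`, then also `limsup f(t)/t^{1/3} ≤ a - 3π²σ²/(2b²)`
(limsups taken in the extended reals). -/
theorem barrier_solution_improve_bound
    (σ a s b : ℝ) (hσ : 0 < σ) (ha : 0 < a) (hs : 0 < s) (hb : 0 < b)
    (f : ℝ → ℝ) (hf : IsBarrierSolution σ a s ⊤ f)
    (hlim : Filter.limsup (fun t : ℝ => ((f t / t ^ ((1:ℝ)/3) : ℝ) : EReal)) Filter.atTop
      ≤ (b : EReal)) :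
    Filter.limsup (fun t : ℝ => ((f t / t ^ ((1:ℝ)/3) : ℝ) : EReal)) Filter.atTop
      ≤ ((a - 3 * Real.pi ^ 2 * σ ^ 2 / (2 * b ^ 2) : ℝ) : EReal) := by
  obtain ⟨hc, hpos, heq⟩ := hf
  have hdom : ∀ t : ℝ, 0 ≤ t → t ∈ barrierDomain ⊤ := fun t ht => ⟨ht, EReal.coe_lt_top t⟩
  set K : ℝ := Real.pi ^ 2 * σ ^ 2 / 2 with hK
  have hK0 : 0 < K := by have := Real.pi_pos; positivity
  have hlimK : a - 3 * Real.pi ^ 2 * σ ^ 2 / (2 * b ^ 2) = a - 3 * K / b ^ 2 := by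
    rw [hK]; field_simp
  rw [hlimK]
  by_contra hcon
  push Not at hcon
  obtain ⟨c, hc1, hc2⟩ := EReal.lt_iff_exists_real_btwn.1 hcon
  have hc1' : a - 3 * K / b ^ 2 < c := by exact_mod_cast hc1
  refine absurd hc2 (not_lt.2 ?_)
  obtain ⟨b', hbb', hb'c⟩ : ∃ b', b < b' ∧ a - 3 * K / b' ^ 2 < c := by
    have hcont : ContinuousAt (fun x : ℝ => a - 3 * K / x ^ 2) b := by
      refine ContinuousAt.sub continuousAt_const (ContinuousAt.div continuousAt_const (by fun_prop) ?_)
      positivity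
    have h1 : ∀ᶠ x in nhdsWithin b (Ioi b), a - 3 * K / x ^ 2 < c :=
      (hcont.eventually_lt continuousAt_const hc1').filter_mono nhdsWithin_le_nhds
    obtain ⟨x, hx, hx2⟩ := (h1.and self_mem_nhdsWithin).exists
    exact ⟨x, hx2, hx⟩
  have hb'0 : 0 < b' := hb.trans hbb'
  have hev : ∀ᶠ t : ℝ in atTop, ((f t / t ^ ((1:ℝ)/3) : ℝ) : EReal) < (b' : EReal) :=
    eventually_lt_of_limsup_lt (lt_of_le_of_lt hlim (by exact_mod_cast hbb'))
  obtain ⟨T, hT⟩ := eventually_atTop.1 hev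
  set T0 : ℝ := max T 1 with hT0
  have hT01 : 1 ≤ T0 := le_max_right _ _
  have hfb : ∀ t, T0 ≤ t → f t ≤ b' * t ^ ((1:ℝ)/3) := by
    intro t ht
    have h := hT t ((le_max_left _ _).trans ht)
    have h' : f t / t ^ ((1:ℝ)/3) < b' := by exact_mod_cast h
    have : 0 < t ^ ((1:ℝ)/3) := Real.rpow_pos_of_pos (by linarith) _
    exact ((div_lt_iff₀ this).1 h').le
  have hint : ∀ t, 0 ≤ t → IntegrableOn (fun u => ((f u) ^ 2)⁻¹) (Ioc 0 t) := by
    intro t ht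
    have : ContinuousOn (fun u => ((f u) ^ 2)⁻¹) (Icc 0 t) := by
      refine ContinuousOn.inv₀ ((hc.mono fun u hu => hdom u hu.1).pow 2) ?_
      intro u hu
      have := hpos u (hdom u hu.1)
      positivity
    exact this.integrableOn_Icc.mono_set Ioc_subset_Icc_self
  have hlow : ∀ t, T0 ≤ t →
      3 / b' ^ 2 * (t ^ ((1:ℝ)/3) - T0 ^ ((1:ℝ)/3)) ≤ ∫ u in Set.Ioc (0:ℝ) t, ((f u) ^ 2)⁻¹ := by
    intro t ht
    have hsub : Ioc T0 t ⊆ Ioc 0 t := Ioc_subset_Ioc_left (by linarith)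
    have hI := hint t (by linarith)
    have h1 : ∫ u in Ioc T0 t, ((f u) ^ 2)⁻¹ ≤ ∫ u in Set.Ioc (0:ℝ) t, ((f u) ^ 2)⁻¹ :=
      setIntegral_mono_set hI (ae_of_all _ fun u => by positivity) hsub.eventuallyLE
    have h2 : ∫ u in Ioc T0 t, (b' ^ 2)⁻¹ * u ^ (-(2:ℝ)/3) ≤ ∫ u in Ioc T0 t, ((f u) ^ 2)⁻¹ := by
      refine setIntegral_mono_on ?_ (hI.mono_set hsub) measurableSet_Ioc ?_
      · have : ContinuousOn (fun u : ℝ => (b' ^ 2)⁻¹ * u ^ (-(2:ℝ)/3)) (Icc T0 t) := by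
          refine continuousOn_const.mul (continuousOn_id.rpow_const ?_)
          intro u hu
          left
          have := hu.1
          simp only [id]
          linarith
        exact this.integrableOn_Icc.mono_set Ioc_subset_Icc_self
      · intro u hu
        have hu0 : 0 < u := by linarith [hu.1]
        have hfu := hpos u (hdom u hu0.le)
        have hh := hfb u hu.1.le
        have e : (b' ^ 2)⁻¹ * u ^ (-(2:ℝ)/3) = ((b' * u ^ ((1:ℝ)/3)) ^ 2)⁻¹ := by
          rw [mul_pow, mul_inv, ← Real.rpow_natCast (u ^ ((1:ℝ)/3)), ← Real.rpow_mul hu0.le,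
            ← Real.rpow_neg hu0.le]
          norm_num
        rw [e]
        gcongr
    have h3 : ∫ u in Ioc T0 t, (b' ^ 2)⁻¹ * u ^ (-(2:ℝ)/3)
        = 3 / b' ^ 2 * (t ^ ((1:ℝ)/3) - T0 ^ ((1:ℝ)/3)) := by
      rw [← intervalIntegral.integral_of_le ht, intervalIntegral.integral_const_mul,
        integral_rpow (Or.inl (by norm_num))]
      norm_num
      field_simp
    linarith
  set C : ℝ := s + 3 * K / b' ^ 2 * T0 ^ ((1:ℝ)/3) with hC
  have htend : Tendsto (fun t : ℝ => t ^ ((1:ℝ)/3)) atTop atTop :=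
    tendsto_rpow_atTop (by norm_num)
  have hd : 0 < c - (a - 3 * K / b' ^ 2) := by linarith
  refine limsup_le_of_le (by isBoundedDefault) ?_
  filter_upwards [eventually_ge_atTop T0,
    htend.eventually_ge_atTop (C / (c - (a - 3 * K / b' ^ 2)))] with t ht hCt
  have h1 := hlow t ht
  have h2 := heq t (hdom t (by linarith))
  have htp : 0 < t ^ ((1:ℝ)/3) := Real.rpow_pos_of_pos (by linarith) _
  have h3 := mul_le_mul_of_nonneg_left h1 hK0.le
  have h4 := (div_le_iff₀ hd).1 hCt
  have e1 : K * (3 / b' ^ 2 * (t ^ ((1:ℝ)/3) - T0 ^ ((1:ℝ)/3)))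
    = 3 * K / b' ^ 2 * t ^ ((1:ℝ)/3) - 3 * K / b' ^ 2 * T0 ^ ((1:ℝ)/3) := by ring
  have h5 : f t / t ^ ((1:ℝ)/3) ≤ c := by
    rw [div_le_iff₀ htp]
    nlinarith
  exact_mod_cast h5
end

section
/- Iterated improvement of upper growth bounds: let s > 0, b₀ > 0, and define the sequence (b_n)_{n≥0} by b_{n+1} := a − 3π²σ²/(2 b_n²); assume b_n > 0 for all n. Let f : [0, ∞) → (0, ∞) be a solution of the barrier equation with parameter a and initial value s on [0, ∞) with limsup_{t→∞} f(t)/t^{1/3} ≤ b₀. Then for every n ≥ 1, limsup_{t→∞} f(t)/t^{1/3} ≤ b_n. -/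
open MeasureTheory Filter Set

lemma barrier_step (σ a s : ℝ) (f : ℝ → ℝ) (hf : IsBarrierSolution σ a s ⊤ f)
    (β : ℝ) (hβ : 0 < β)
    (hlim : Filter.limsup (fun t : ℝ => ((f t / t ^ ((1:ℝ)/3) : ℝ) : EReal)) Filter.atTop
      ≤ (β : EReal)) :
    Filter.limsup (fun t : ℝ => ((f t / t ^ ((1:ℝ)/3) : ℝ) : EReal)) Filter.atTop
      ≤ ((a - 3 * Real.pi ^ 2 * σ ^ 2 / (2 * β ^ 2) : ℝ) : EReal) := by
  obtain ⟨hc, hpos, heq⟩ := hf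
  have hdom : barrierDomain ⊤ = Ici 0 := by
    ext t; simp [barrierDomain, EReal.coe_lt_top]
  rw [hdom] at hc hpos heq
  rw [← EReal.le_of_forall_lt_iff_le]
  intro d hd
  rw [EReal.coe_lt_coe_iff] at hd
  -- choose a slightly larger bound
  have hcont : Tendsto (fun x : ℝ => a - 3 * Real.pi ^ 2 * σ ^ 2 / (2 * x ^ 2)) (nhdsWithin β (Ioi β))
      (nhds (a - 3 * Real.pi ^ 2 * σ ^ 2 / (2 * β ^ 2))) := by
    have : ContinuousAt (fun x : ℝ => a - 3 * Real.pi ^ 2 * σ ^ 2 / (2 * x ^ 2)) β := by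
      apply ContinuousAt.sub continuousAt_const
      apply ContinuousAt.div continuousAt_const (by fun_prop)
      positivity
    exact this.tendsto.mono_left nhdsWithin_le_nhds
  obtain ⟨B, hB1, hB2⟩ := ((hcont.eventually (gt_mem_nhds hd)).and self_mem_nhdsWithin).exists
  have hB2 : β < B := hB2
  have hB : 0 < B := hβ.trans hB2
  have hev := Filter.eventually_lt_of_limsup_lt (hlim.trans_lt (EReal.coe_lt_coe_iff.2 hB2))
  obtain ⟨t1, ht1⟩ := eventually_atTop.1 hev
  set t0 := max t1 1 with ht0
  have ht0pos : 0 < t0 := lt_of_lt_of_le one_pos (le_max_right _ _)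
  have hbound : ∀ t, t0 ≤ t → f t ≤ B * t ^ ((1:ℝ)/3) := by
    intro t ht
    have h1 := ht1 t ((le_max_left _ _).trans ht)
    rw [EReal.coe_lt_coe_iff] at h1
    have : 0 < t ^ ((1:ℝ)/3) := Real.rpow_pos_of_pos (ht0pos.trans_le ht) _
    exact ((div_lt_iff₀ this).1 h1).le
  have hcinv : ContinuousOn (fun u => ((f u) ^ 2)⁻¹) (Ici 0) := by
    apply ContinuousOn.inv₀ (hc.pow 2)
    intro x hx
    exact pow_ne_zero _ (hpos x hx).ne'
  have hint : ∀ t, t0 ≤ t → 3 * (t ^ ((1:ℝ)/3) - t0 ^ ((1:ℝ)/3)) / B ^ 2 ≤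
      ∫ u in Set.Ioc (0:ℝ) t, ((f u) ^ 2)⁻¹ := by
    intro t ht
    have hi : IntegrableOn (fun u => ((f u) ^ 2)⁻¹) (Icc 0 t) :=
      (hcinv.mono Icc_subset_Ici_self).integrableOn_Icc
    have e1 : ∫ u in Set.Ioc t0 t, ((f u) ^ 2)⁻¹ ≤ ∫ u in Set.Ioc (0:ℝ) t, ((f u) ^ 2)⁻¹ := by
      apply setIntegral_mono_set (hi.mono_set Ioc_subset_Icc_self)
      · exact Eventually.of_forall fun x => by positivity
      · exact (Ioc_subset_Ioc_left ht0pos.le).eventuallyLE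
    refine le_trans ?_ e1
    have e2 : 3 * (t ^ ((1:ℝ)/3) - t0 ^ ((1:ℝ)/3)) / B ^ 2
        = ∫ u in t0..t, (B ^ 2)⁻¹ * u ^ (-(2:ℝ)/3) := by
      rw [intervalIntegral.integral_const_mul, integral_rpow (Or.inl ?_)]
      · norm_num
        ring
      · norm_num
    rw [e2, ← intervalIntegral.integral_of_le ht]
    have h0u : ∀ u ∈ Icc t0 t, 0 < u := fun u hu => ht0pos.trans_le hu.1
    apply intervalIntegral.integral_mono_on ht
    · apply ContinuousOn.intervalIntegrable
      rw [uIcc_of_le ht]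
      apply ContinuousOn.mul continuousOn_const
      intro u hu
      exact (Real.continuousAt_rpow_const _ _ (Or.inl (h0u u hu).ne')).continuousWithinAt
    · apply ContinuousOn.intervalIntegrable
      rw [uIcc_of_le ht]
      exact hcinv.mono fun u hu => (h0u u hu).le
    · intro u hu
      have hu0 := h0u u hu
      have hfu := hpos u hu0.le
      have e3 : (B ^ 2)⁻¹ * u ^ (-(2:ℝ)/3) = ((B * u ^ ((1:ℝ)/3)) ^ 2)⁻¹ := by
        rw [mul_pow, mul_inv, ← Real.rpow_natCast (u ^ ((1:ℝ)/3)) 2, ← Real.rpow_mul hu0.le,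
          ← Real.rpow_neg hu0.le]
        norm_num
      rw [e3]
      have := hbound u hu.1
      gcongr
  set K := Real.pi ^ 2 * σ ^ 2 / 2 with hK
  have hK0 : 0 ≤ K := by positivity
  set m := a - 3 * Real.pi ^ 2 * σ ^ 2 / (2 * B ^ 2) with hm
  set C := s + K * (3 * t0 ^ ((1:ℝ)/3) / B ^ 2) with hC
  have hT : Tendsto (fun t : ℝ => t ^ ((1:ℝ)/3)) atTop atTop := tendsto_rpow_atTop (by norm_num)
  apply Filter.limsup_le_of_le
  · isBoundedDefault
  filter_upwards [hT.eventually_ge_atTop (C / (d - m)), eventually_ge_atTop t0] with t h1 h2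
  rw [EReal.coe_le_coe_iff]
  have htp : 0 < t ^ ((1:ℝ)/3) := Real.rpow_pos_of_pos (ht0pos.trans_le h2) _
  rw [div_le_iff₀ htp]
  have h3 := heq t (ht0pos.trans_le h2).le
  have h4 := mul_le_mul_of_nonneg_left (hint t h2) hK0
  rw [div_le_iff₀ (by linarith)] at h1
  have h5 : K * (3 * (t ^ ((1:ℝ)/3) - t0 ^ ((1:ℝ)/3)) / B ^ 2)
      = (a - m) * t ^ ((1:ℝ)/3) - (C - s) := by
    rw [hm, hC, hK]; field_simp; ring
  rw [h5] at h4
  nlinarith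

/-- Iterated improvement of upper growth bounds along the recursion
`b_{n+1} = a - 3π²σ²/(2 b_n²)`. -/
theorem barrier_solution_improve_bound_iter
    (σ a s : ℝ) (hσ : 0 < σ) (ha : 0 < a) (hs : 0 < s)
    (b : ℕ → ℝ) (hbpos : ∀ n, 0 < b n)
    (hrec : ∀ n, b (n + 1) = a - 3 * Real.pi ^ 2 * σ ^ 2 / (2 * (b n) ^ 2))
    (f : ℝ → ℝ) (hf : IsBarrierSolution σ a s ⊤ f)
    (hlim : Filter.limsup (fun t : ℝ => ((f t / t ^ ((1:ℝ)/3) : ℝ) : EReal)) Filter.atTop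
      ≤ (b 0 : EReal)) :
    ∀ n : ℕ, 1 ≤ n →
      Filter.limsup (fun t : ℝ => ((f t / t ^ ((1:ℝ)/3) : ℝ) : EReal)) Filter.atTop
        ≤ (b n : EReal) := by
  intro n _
  induction n with
  | zero => exact hlim
  | succ k ih =>
    have h0 : Filter.limsup (fun t : ℝ => ((f t / t ^ ((1:ℝ)/3) : ℝ) : EReal)) Filter.atTop
        ≤ (b k : EReal) := by
      rcases Nat.eq_zero_or_pos k with rfl | hk
      · exact hlim
      · exact ih hk
    rw [hrec k]
    exact barrier_step σ a s f hf (b k) (hbpos k) h0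
end

section
/- Comparison with the exact power solution: let σ > 0, b > 0, s > 0, set a := b + 3π²σ²/(2b²), and let T ∈ (0, ∞]. If f : [0, T) → (0, ∞) is a solution of the barrier equation with parameter a and initial value s on [0, T), then f(t) ≥ b t^{1/3} for all t ∈ [0, T). -/
open MeasureTheory Filter Set

/-- Comparison with the exact power solution: if `a = b + 3π²σ²/(2b²)` then any barrier
solution with initial value `s > 0` dominates `t ↦ b t^{1/3}` on its domain. -/
theorem barrier_solution_ge_power
    (σ b s : ℝ) (hσ : 0 < σ) (hb : 0 < b) (hs : 0 < s)
    (T : EReal) (hT : 0 < T)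
    (f : ℝ → ℝ)
    (hf : IsBarrierSolution σ (b + 3 * Real.pi ^ 2 * σ ^ 2 / (2 * b ^ 2)) s T f) :
    ∀ t ∈ barrierDomain T, b * t ^ ((1:ℝ)/3) ≤ f t := by
  obtain ⟨hc, hpos, heq⟩ := hf
  intro t1 ht1
  by_contra hlt
  push Not at hlt
  have hsub : Icc 0 t1 ⊆ barrierDomain T := fun x hx =>
    ⟨hx.1, lt_of_le_of_lt (by exact_mod_cast hx.2) ht1.2⟩
  have hgc : Continuous (fun t : ℝ => b * t ^ ((1:ℝ)/3)) :=
    continuous_const.mul (Real.continuous_rpow_const (by norm_num))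
  have hdc : ContinuousOn (fun t => f t - b * t ^ ((1:ℝ)/3)) (Icc 0 t1) :=
    (hc.mono hsub).sub hgc.continuousOn
  have hScl : IsClosed (Icc 0 t1 ∩ (fun t => f t - b * t ^ ((1:ℝ)/3)) ⁻¹' Iic 0) :=
    hdc.preimage_isClosed_of_isClosed isClosed_Icc isClosed_Iic
  set S := Icc 0 t1 ∩ (fun t => f t - b * t ^ ((1:ℝ)/3)) ⁻¹' Iic 0 with hS
  have hne : S.Nonempty := ⟨t1, ⟨ht1.1, le_rfl⟩, by
    simp only [mem_preimage, mem_Iic]; linarith⟩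
  have hbdd : BddBelow S := ⟨0, fun x hx => hx.1.1⟩
  have h0 : sInf S ∈ S := hScl.csInf_mem hne hbdd
  set t0 := sInf S with ht0
  have hd0 : f t0 - b * t0 ^ ((1:ℝ)/3) ≤ 0 := h0.2
  have hbefore : ∀ u ∈ Ioo 0 t0, b * u ^ ((1:ℝ)/3) ≤ f u := by
    intro u hu
    by_contra h
    push Not at h
    have : u ∈ S := ⟨⟨hu.1.le, hu.2.le.trans h0.1.2⟩, by
      simp only [mem_preimage, mem_Iic]; linarith⟩
    exact absurd (csInf_le hbdd this) (not_le.mpr hu.2)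
  have e := heq t0 (hsub h0.1)
  have hint : IntervalIntegrable (fun u : ℝ => (b^2)⁻¹ * u ^ (-(2:ℝ)/3)) volume 0 t0 :=
    (intervalIntegral.intervalIntegrable_rpow' (by norm_num)).const_mul _
  have hval : ∫ u in Ioo 0 t0, (b^2)⁻¹ * u ^ (-(2:ℝ)/3) = (b^2)⁻¹ * (3 * t0 ^ ((1:ℝ)/3)) := by
    rw [← integral_Ioc_eq_integral_Ioo, ← intervalIntegral.integral_of_le h0.1.1,
      intervalIntegral.integral_const_mul, integral_rpow (Or.inl (by norm_num))]
    norm_num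
    left
    ring
  have hle : ∫ u in Ioc 0 t0, ((f u) ^ 2)⁻¹ ≤ (b^2)⁻¹ * (3 * t0 ^ ((1:ℝ)/3)) := by
    rw [integral_Ioc_eq_integral_Ioo, ← hval]
    apply integral_mono_of_nonneg
    · exact Eventually.of_forall fun u => by positivity
    · exact ((intervalIntegrable_iff_integrableOn_Ioc_of_le h0.1.1).1 hint).mono_set
        Ioo_subset_Ioc_self
    · refine (ae_restrict_mem measurableSet_Ioo).mono fun u hu => ?_
      have hu0 : 0 < u := hu.1
      have h1 : (b^2)⁻¹ * u ^ (-(2:ℝ)/3) = ((b * u ^ ((1:ℝ)/3))^2)⁻¹ := by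
        rw [mul_pow, mul_inv, ← Real.rpow_natCast (u ^ ((1:ℝ)/3)), ← Real.rpow_mul hu0.le,
          ← Real.rpow_neg hu0.le]
        norm_num
      show ((f u) ^ 2)⁻¹ ≤ (b^2)⁻¹ * u ^ (-(2:ℝ)/3)
      rw [h1]
      have := hbefore u hu
      have : 0 < b * u ^ ((1:ℝ)/3) := by positivity
      gcongr
  have hm := mul_le_mul_of_nonneg_left hle (show 0 ≤ Real.pi ^ 2 * σ ^ 2 / 2 by positivity)
  have hid : Real.pi ^ 2 * σ ^ 2 / 2 * ((b^2)⁻¹ * (3 * t0 ^ ((1:ℝ)/3)))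
      = 3 * Real.pi ^ 2 * σ ^ 2 / (2 * b ^ 2) * t0 ^ ((1:ℝ)/3) := by
    field_simp
  rw [hid] at hm
  rw [add_mul] at e
  linarith
end

section
/- Gronwall bound on the deviation from the power solution: let σ > 0, b > 0, s > 0, set a := b + 3π²σ²/(2b²), and let f : [0, T) → (0, ∞) be a solution of the barrier equation with parameter a and initial value s on [0, T) (so that h(t) := f(t) − b t^{1/3} ≥ 0 on [0, T)). Then for all t₀, t with 0 < t₀ ≤ t < T, one has h(t) ≤ h(t₀) · (t/t₀)^{π²σ²/b³}. -/
open MeasureTheory Filter Set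

theorem barrier_aux_ineq (x y : ℝ) (hx : 0 < x) (hy : 0 < y) :
    (y ^ 2)⁻¹ - (x ^ 2)⁻¹ ≤ 2 * (x - y) / y ^ 3 := by
  have h : 2 * (x - y) / y ^ 3 - ((y ^ 2)⁻¹ - (x ^ 2)⁻¹)
      = (x - y) ^ 2 * (2 * x + y) / (x ^ 2 * y ^ 3) := by
    field_simp
    ring
  have h2 : 0 ≤ (x - y) ^ 2 * (2 * x + y) / (x ^ 2 * y ^ 3) := by positivity
  linarith

theorem barrier_aux_deriv (σ a s : ℝ) (T : EReal) (f : ℝ → ℝ)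
    (hf : IsBarrierSolution σ a s T f) (t x : ℝ) (hx : 0 < x) (hxt : x < t)
    (htT : (t : EReal) < T) :
    HasDerivAt f (a * ((1:ℝ)/3 * x ^ ((1:ℝ)/3 - 1))
      - Real.pi ^ 2 * σ ^ 2 / 2 * ((f x) ^ 2)⁻¹) x := by
  obtain ⟨hc, hp, he⟩ := hf
  have hsub : ∀ u : ℝ, 0 ≤ u → u ≤ t → u ∈ barrierDomain T := fun u h0 h1 =>
    ⟨h0, lt_of_le_of_lt (EReal.coe_le_coe_iff.2 h1) htT⟩
  have hci : ContinuousOn (fun u => ((f u) ^ 2)⁻¹) (Icc 0 t) := by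
    apply ContinuousOn.inv₀
    · exact (hc.mono fun u hu => hsub u hu.1 hu.2).pow 2
    · intro u hu
      have := hp u (hsub u hu.1 hu.2)
      positivity
  have hI : HasDerivAt (fun y => ∫ u in (0:ℝ)..y, ((f u) ^ 2)⁻¹) (((f x) ^ 2)⁻¹) x := by
    apply intervalIntegral.integral_hasDerivAt_right
    · apply ContinuousOn.intervalIntegrable
      rw [uIcc_of_le hx.le]
      exact hci.mono (Icc_subset_Icc le_rfl hxt.le)
    · exact (hci.mono Ioo_subset_Icc_self).stronglyMeasurableAtFilter isOpen_Ioo x ⟨hx, hxt⟩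
    · exact hci.continuousAt (Icc_mem_nhds hx hxt)
  have hr : HasDerivAt (fun y : ℝ => y ^ ((1:ℝ)/3)) ((1:ℝ)/3 * x ^ ((1:ℝ)/3 - 1)) x :=
    Real.hasDerivAt_rpow_const (Or.inl hx.ne')
  have hD := ((hr.const_mul a).const_add s).sub (hI.const_mul (Real.pi ^ 2 * σ ^ 2 / 2))
  refine hD.congr_of_eventuallyEq ?_
  filter_upwards [Ioo_mem_nhds hx hxt] with y hy
  have := he y (hsub y hy.1.le hy.2.le)
  rw [← intervalIntegral.integral_of_le hy.1.le] at this
  simp only [Pi.sub_apply]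
  linarith

/-- Gronwall bound on the deviation `h(t) = f(t) - b t^{1/3}` from the power solution:
`h(t) ≤ h(t₀) (t/t₀)^{π²σ²/b³}` for `0 < t₀ ≤ t < T`. -/
theorem barrier_solution_gronwall
    (σ b s : ℝ) (hσ : 0 < σ) (hb : 0 < b) (hs : 0 < s)
    (T : EReal) (hT : 0 < T)
    (f : ℝ → ℝ)
    (hf : IsBarrierSolution σ (b + 3 * Real.pi ^ 2 * σ ^ 2 / (2 * b ^ 2)) s T f) :
    ∀ t₀ t : ℝ, 0 < t₀ → t₀ ≤ t → (t : EReal) < T →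
      f t - b * t ^ ((1:ℝ)/3)
        ≤ (f t₀ - b * t₀ ^ ((1:ℝ)/3)) * (t / t₀) ^ (Real.pi ^ 2 * σ ^ 2 / b ^ 3) := by
  intro t₀ t h0 hle htT
  have htpos : 0 < t := h0.trans_le hle
  set k : ℝ := Real.pi ^ 2 * σ ^ 2 / b ^ 3 with hk
  have hsub : ∀ u : ℝ, 0 ≤ u → u ≤ t → u ∈ barrierDomain T := fun u h0 h1 =>
    ⟨h0, lt_of_le_of_lt (EReal.coe_le_coe_iff.2 h1) htT⟩
  have hder : ∀ x ∈ Ioo t₀ t, ∃ d ≤ 0,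
      HasDerivAt (fun y => (f y - b * y ^ ((1:ℝ)/3)) * y ^ (-k)) d x := by
    intro x hx
    have hx0 : 0 < x := h0.trans hx.1
    have hfx : 0 < f x := hf.2.1 x (hsub x hx0.le hx.2.le)
    have h1 := barrier_aux_deriv σ _ s T f hf t x hx0 hx.2 htT
    have hr : HasDerivAt (fun y : ℝ => y ^ ((1:ℝ)/3)) ((1:ℝ)/3 * x ^ ((1:ℝ)/3 - 1)) x :=
      Real.hasDerivAt_rpow_const (Or.inl hx0.ne')
    have hr2 : HasDerivAt (fun y : ℝ => y ^ (-k)) (-k * x ^ (-k - 1)) x :=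
      Real.hasDerivAt_rpow_const (Or.inl hx0.ne')
    refine ⟨_, ?_, (h1.sub (hr.const_mul b)).mul hr2⟩
    simp only [Pi.sub_apply]
    obtain ⟨r, hrd⟩ : ∃ r, r = x ^ ((1:ℝ)/3) := ⟨_, rfl⟩
    have hrpos : 0 < r := hrd ▸ Real.rpow_pos_of_pos hx0 _
    have hr3 : x = r ^ 3 := by
      rw [hrd, ← Real.rpow_natCast, ← Real.rpow_mul hx0.le]; norm_num
    have e1 : x ^ ((1:ℝ)/3 - 1) = (r ^ 2)⁻¹ := by
      rw [Real.rpow_sub_one hx0.ne', ← hrd, hr3]; field_simp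
    have e2 : x ^ (-k - 1) = x ^ (-k) / r ^ 3 := by
      rw [Real.rpow_sub_one hx0.ne', ← hr3]
    rw [e1, e2, ← hrd]
    have hp : 0 < x ^ (-k) := Real.rpow_pos_of_pos hx0 _
    have key := barrier_aux_ineq (f x) (b * r) hfx (by positivity)
    have hcc : 0 ≤ Real.pi ^ 2 * σ ^ 2 / 2 * x ^ (-k) := by positivity
    have := mul_le_mul_of_nonneg_left key hcc
    have e3 : ((b + 3 * Real.pi ^ 2 * σ ^ 2 / (2 * b ^ 2)) * (1 / 3 * (r ^ 2)⁻¹) -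
          Real.pi ^ 2 * σ ^ 2 / 2 * (f x ^ 2)⁻¹ - b * (1 / 3 * (r ^ 2)⁻¹)) * x ^ (-k) +
        (f x - b * r) * (-k * (x ^ (-k) / r ^ 3))
        = Real.pi ^ 2 * σ ^ 2 / 2 * x ^ (-k) * (((b * r) ^ 2)⁻¹ - (f x ^ 2)⁻¹)
          - Real.pi ^ 2 * σ ^ 2 / 2 * x ^ (-k) * (2 * (f x - b * r) / (b * r) ^ 3) := by
      generalize x ^ (-k) = p
      rw [hk]
      field_simp
      ring
    rw [e3]
    linarith
  have hanti : AntitoneOn (fun y => (f y - b * y ^ ((1:ℝ)/3)) * y ^ (-k)) (Icc t₀ t) := by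
    apply antitoneOn_of_deriv_nonpos (convex_Icc _ _)
    · have hfc : ContinuousOn f (Icc t₀ t) :=
        hf.1.mono fun u hu => hsub u (h0.le.trans hu.1) hu.2
      have hpc : ∀ q : ℝ, ContinuousOn (fun y : ℝ => y ^ q) (Icc t₀ t) := fun q =>
        continuousOn_id.rpow_const fun u hu => Or.inl (h0.trans_le hu.1).ne'
      exact (hfc.sub (continuousOn_const.mul (hpc _))).mul (hpc _)
    · rw [interior_Icc]
      intro x hx
      obtain ⟨d, -, hd⟩ := hder x hx
      exact hd.differentiableAt.differentiableWithinAt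
    · rw [interior_Icc]
      intro x hx
      obtain ⟨d, hd0, hd⟩ := hder x hx
      rw [hd.deriv]; exact hd0
  have hfin := hanti (left_mem_Icc.2 hle) (right_mem_Icc.2 hle) hle
  simp only at hfin
  rw [Real.rpow_neg htpos.le, Real.rpow_neg h0.le] at hfin
  rw [Real.div_rpow htpos.le h0.le]
  have hp : 0 < t ^ k := Real.rpow_pos_of_pos htpos _
  have := mul_le_mul_of_nonneg_right hfin hp.le
  rw [mul_assoc, inv_mul_cancel₀ hp.ne', mul_one] at this
  calc _ ≤ _ := this
    _ = _ := by rw [div_eq_mul_inv]; ring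
end

section
/- Convergence of the critical improvement iteration: let σ > 0, a_c := (3/2)(3π²σ²)^{1/3}, and let b₀ > 2a_c/3. Define (b_n)_{n≥0} by b_{n+1} := a_c − 3π²σ²/(2 b_n²). Then b_n > 2a_c/3 for all n, the sequence (b_n) is strictly decreasing, and b_n → 2a_c/3 as n → ∞. -/
/-- Convergence of the critical improvement iteration
`b_{n+1} = a_c - 3π²σ²/(2 b_n²)` started from `b₀ > 2a_c/3`: the sequence stays above
`2a_c/3`, is strictly decreasing, and converges to `2a_c/3`. -/
theorem critical_iteration_convergence
    (σ b₀ : ℝ) (hσ : 0 < σ) (hb₀ : 2 * aCrit σ / 3 < b₀)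
    (b : ℕ → ℝ) (hb0 : b 0 = b₀)
    (hrec : ∀ n : ℕ, b (n + 1) = aCrit σ - 3 * Real.pi ^ 2 * σ ^ 2 / (2 * (b n) ^ 2)) :
    (∀ n : ℕ, 2 * aCrit σ / 3 < b n) ∧ StrictAnti b ∧
      Filter.Tendsto b Filter.atTop (nhds (2 * aCrit σ / 3)) := by
  obtain ⟨c, hc, hcK, hac⟩ : ∃ c : ℝ, 0 < c ∧ 3 * Real.pi ^ 2 * σ ^ 2 = c ^ 3 ∧
      aCrit σ = 3 / 2 * c := by
    have hK : 0 < 3 * Real.pi ^ 2 * σ ^ 2 := by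
      have := Real.pi_pos
      positivity
    refine ⟨(3 * Real.pi ^ 2 * σ ^ 2) ^ ((1:ℝ)/3), Real.rpow_pos_of_pos hK _, ?_, rfl⟩
    generalize 3 * Real.pi ^ 2 * σ ^ 2 = K at hK
    rw [← Real.rpow_natCast, ← Real.rpow_mul hK.le]
    norm_num
  have h2 : 2 * aCrit σ / 3 = c := by rw [hac]; ring
  rw [h2] at hb₀ ⊢
  rw [hcK, hac] at hrec
  have hpos : ∀ n, c < b n := by
    intro n
    induction n with
    | zero => rw [hb0]; exact hb₀
    | succ k ih =>
      have hb : 0 < b k := hc.trans ih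
      have key : b (k + 1) - c = c * (b k - c) * (b k + c) / (2 * b k ^ 2) := by
        rw [hrec]; field_simp; ring
      have : 0 < c * (b k - c) * (b k + c) / (2 * b k ^ 2) := by
        have : 0 < b k - c := sub_pos.2 ih
        positivity
      linarith
  have hanti : StrictAnti b := by
    refine strictAnti_nat_of_succ_lt fun k => ?_
    have hb : 0 < b k := hc.trans (hpos k)
    have key : b k - b (k + 1) = (b k - c) ^ 2 * (2 * b k + c) / (2 * b k ^ 2) := by
      rw [hrec]; field_simp; ring
    have : 0 < (b k - c) ^ 2 * (2 * b k + c) / (2 * b k ^ 2) := by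
      have : 0 < b k - c := sub_pos.2 (hpos k)
      positivity
    linarith
  refine ⟨hpos, hanti, ?_⟩
  have hbdd : BddBelow (Set.range b) := ⟨c, by rintro _ ⟨n, rfl⟩; exact (hpos n).le⟩
  have hL := tendsto_atTop_ciInf hanti.antitone hbdd
  generalize (⨅ i, b i) = L at hL
  have hcL : c ≤ L := ge_of_tendsto' hL fun n => (hpos n).le
  have hL0 : 0 < L := hc.trans_le hcL
  have h1 : Filter.Tendsto (fun n => b (n + 1)) Filter.atTop (nhds L) :=
    hL.comp (Filter.tendsto_add_atTop_nat 1)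
  have h3 : Filter.Tendsto (fun n => b (n + 1)) Filter.atTop
      (nhds (3 / 2 * c - c ^ 3 / (2 * L ^ 2))) := by
    simp only [hrec]
    exact tendsto_const_nhds.sub
      (tendsto_const_nhds.div ((hL.pow 2).const_mul 2) (by positivity))
  have heq := tendsto_nhds_unique h1 h3
  have h4 : (L - c) ^ 2 * (2 * L + c) = 0 := by
    field_simp at heq
    linear_combination heq
  have h5 : L = c := by
    rcases mul_eq_zero.1 h4 with h | h
    · have := pow_eq_zero_iff (two_ne_zero) |>.1 h
      linarith
    · linarith
  rwa [h5] at hL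
end

section
/- Existence criterion for the critical tilt: assume in addition μ(ℝ) > 1 and μ((−∞, 0)) > 0. Then there exists t* > 0 with t*·Ψ'(t*) = Ψ(t*) if and only if either the topological support of μ is not bounded below, or it is bounded below and μ({x_min}) < 1, where x_min := inf(supp μ). -/
open MeasureTheory Filter Set
open scoped ENNReal

/-- The topological support of a Borel measure on `ℝ`: the set of points all of whose
neighbourhoods have positive measure (the smallest closed set of full measure). -/
def msupport (μ : Measure ℝ) : Set ℝ := {x : ℝ | ∀ U ∈ nhds x, 0 < μ U}

/-- The Laplace transform `Φ(t) = ∫ e^{-tz} dμ(z)`. -/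
noncomputable def lapl (μ : Measure ℝ) (t : ℝ) : ℝ := ∫ z, Real.exp (-t * z) ∂μ

/-- The log-Laplace transform `Ψ = log Φ`. -/
noncomputable def logLapl (μ : Measure ℝ) (t : ℝ) : ℝ := Real.log (lapl μ t)

open Topology ProbabilityTheory

lemma ct_mem (μ : Measure ℝ)
    (hΦ : ∀ t : ℝ, 0 ≤ t → Integrable (fun z => Real.exp (-t * z)) μ) {t : ℝ} (ht : 0 < t) :
    t ∈ interior (integrableExpSet (fun z : ℝ => -z) μ) := by
  rw [mem_interior_iff_mem_nhds]
  filter_upwards [Ioi_mem_nhds ht] with s hs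
  have := hΦ s (le_of_lt hs)
  simpa [integrableExpSet] using this

lemma ct_int (μ : Measure ℝ)
    (hΦ : ∀ t : ℝ, 0 ≤ t → Integrable (fun z => Real.exp (-t * z)) μ) {t : ℝ} (ht : 0 < t) :
    Integrable (fun z => z * Real.exp (-t * z)) μ := by
  have := (integrable_pow_mul_exp_of_mem_interior_integrableExpSet (ct_mem μ hΦ ht) 1).neg
  refine this.congr (Eventually.of_forall fun z => ?_)
  simp

lemma ct_deriv (μ : Measure ℝ)
    (hΦ : ∀ t : ℝ, 0 ≤ t → Integrable (fun z => Real.exp (-t * z)) μ) {t : ℝ} (ht : 0 < t) :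
    HasDerivAt (lapl μ) (- ∫ z, z * Real.exp (-t * z) ∂μ) t := by
  have := hasDerivAt_mgf (ct_mem μ hΦ ht)
  have e : mgf (fun z : ℝ => -z) μ = lapl μ := by
    funext s; simp [mgf, lapl]
  rw [e] at this
  convert! this using 1
  rw [← integral_neg]
  congr 1; funext z; simp

lemma ct_lower (μ : Measure ℝ) [IsFiniteMeasure μ]
    (hΦ : ∀ t : ℝ, 0 ≤ t → Integrable (fun z => Real.exp (-t * z)) μ) {t : ℝ} (ht : 0 ≤ t)
    {s : Set ℝ} (hs : MeasurableSet s) {x : ℝ} (hsx : ∀ z ∈ s, z ≤ x) :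
    Real.exp (-t * x) * μ.real s ≤ lapl μ t := by
  calc Real.exp (-t * x) * μ.real s = ∫ z in s, Real.exp (-t * x) ∂μ := by
        simp [mul_comm]
    _ ≤ ∫ z in s, Real.exp (-t * z) ∂μ := by
        refine setIntegral_mono_on (integrable_const _) (hΦ t ht).integrableOn hs fun z hz => ?_
        apply Real.exp_le_exp.2
        have := hsx z hz
        nlinarith
    _ ≤ lapl μ t := setIntegral_le_integral (hΦ t ht)
        (Eventually.of_forall fun z => (Real.exp_pos _).le)

lemma ct_pos (μ : Measure ℝ) [IsFiniteMeasure μ] (hμ : μ ≠ 0)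
    (hΦ : ∀ t : ℝ, 0 ≤ t → Integrable (fun z => Real.exp (-t * z)) μ) {t : ℝ} (ht : 0 ≤ t) :
    0 < lapl μ t := by
  have : NeZero μ := ⟨hμ⟩
  exact integral_exp_pos (hΦ t ht)

lemma ct_supp (μ : Measure ℝ) : msupport μ = μ.support := by
  ext x; simp [msupport, Measure.mem_support_iff_forall]

lemma ct_ae (μ : Measure ℝ) (hb : BddBelow (msupport μ)) :
    ∀ᵐ z ∂μ, sInf (msupport μ) ≤ z := by
  have h : μ.support ∈ ae μ := Measure.support_mem_ae
  filter_upwards [h] with z hz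
  exact csInf_le hb (by rwa [ct_supp])

lemma ct_iio (μ : Measure ℝ) {x y : ℝ} (hx : x ∈ msupport μ) (hxy : x < y) :
    0 < μ (Iio y) := hx _ (Iio_mem_nhds hxy)

lemma ct_tendsto_zero (μ : Measure ℝ) [IsFiniteMeasure μ]
    (hΦ : ∀ t : ℝ, 0 ≤ t → Integrable (fun z => Real.exp (-t * z)) μ) :
    Tendsto (lapl μ) (𝓝[>] 0) (𝓝 (μ.real univ)) := by
  have h : Tendsto (fun t => ∫ z, Real.exp (-t * z) ∂μ) (𝓝[>] (0:ℝ))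
      (𝓝 (∫ z, (fun _ => (1:ℝ)) z ∂μ)) := by
    refine tendsto_integral_filter_of_dominated_convergence
      (fun z => 1 + Real.exp (-1 * z)) ?_ ?_ ?_ ?_
    · exact Eventually.of_forall fun t => by fun_prop
    · filter_upwards [Ioo_mem_nhdsGT (zero_lt_one (α := ℝ))] with t ht
      refine Eventually.of_forall fun z => ?_
      rw [Real.norm_eq_abs, abs_of_pos (Real.exp_pos _)]
      rcases le_total 0 z with hz | hz
      · have : Real.exp (-t * z) ≤ 1 := Real.exp_le_one_iff.2 (by nlinarith [ht.1])
        linarith [Real.exp_pos (-1 * z)]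
      · have : Real.exp (-t * z) ≤ Real.exp (-1 * z) := Real.exp_le_exp.2 (by nlinarith [ht.2])
        linarith
    · exact (integrable_const _).add (hΦ 1 zero_le_one)
    · refine Eventually.of_forall fun z => ?_
      have : Continuous fun t : ℝ => Real.exp (-t * z) := by fun_prop
      have := (this.tendsto 0).mono_left (nhdsWithin_le_nhds (s := Ioi 0))
      simpa using this
  rw [integral_const, smul_eq_mul, mul_one] at h
  exact h

lemma ct_tendsto_top (μ : Measure ℝ) [IsFiniteMeasure μ] {m : ℝ} (hm : ∀ᵐ z ∂μ, m ≤ z) :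
    Tendsto (fun t => ∫ z, Real.exp (-t * (z - m)) ∂μ) atTop (𝓝 (μ.real {m})) := by
  have h : Tendsto (fun t => ∫ z, Real.exp (-t * (z - m)) ∂μ) atTop
      (𝓝 (∫ z, ({m} : Set ℝ).indicator (fun _ => (1:ℝ)) z ∂μ)) := by
    refine tendsto_integral_filter_of_dominated_convergence
      (fun z => 1) ?_ ?_ (integrable_const _) ?_
    · exact Eventually.of_forall fun t => by fun_prop
    · filter_upwards [eventually_ge_atTop (0:ℝ)] with t ht
      filter_upwards [hm] with z hz
      rw [Real.norm_eq_abs, abs_of_pos (Real.exp_pos _)]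
      exact Real.exp_le_one_iff.2 (by nlinarith)
    · filter_upwards [hm] with z hz
      rcases hz.eq_or_lt with rfl | hz
      · simp
      · have : z ∉ ({m} : Set ℝ) := by simpa using hz.ne'
        rw [indicator_of_notMem this]
        refine Real.tendsto_exp_atBot.comp ?_
        have h2 : Tendsto (fun t : ℝ => t * (z - m)) atTop atTop :=
          tendsto_id.atTop_mul_const (sub_pos.2 hz)
        refine (tendsto_neg_atTop_atBot.comp h2).congr fun t => ?_
        simp
  rwa [integral_indicator (measurableSet_singleton m), setIntegral_const, smul_eq_mul,
    mul_one] at h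

lemma ct_forward (μ : Measure ℝ) [IsFiniteMeasure μ] (hμ : μ ≠ 0)
    (hΦ : ∀ t : ℝ, 0 ≤ t → Integrable (fun z => Real.exp (-t * z)) μ)
    (hmass : 1 < μ.real univ) {t : ℝ} (ht : 0 < t)
    (he : t * deriv (logLapl μ) t = logLapl μ t) (hb : BddBelow (msupport μ)) :
    μ.real {sInf (msupport μ)} < 1 := by
  by_contra! h1
  have hm := ct_ae μ hb
  set m := sInf (msupport μ)
  have hp := ct_pos μ hμ hΦ ht.le
  have hd := ((ct_deriv μ hΦ ht).log hp.ne').deriv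
  have hI : ∫ z, (z - m) * Real.exp (-t * z) ∂μ
      = (∫ z, z * Real.exp (-t * z) ∂μ) - m * lapl μ t := by
    rw [lapl, ← integral_const_mul, ← integral_sub (ct_int μ hΦ ht) ((hΦ t ht.le).const_mul m)]
    congr 1; funext z; ring
  have hnn : 0 ≤ᵐ[μ] fun z => (z - m) * Real.exp (-t * z) := by
    filter_upwards [hm] with z hz
    exact mul_nonneg (sub_nonneg.2 hz) (Real.exp_pos _).le
  have hI0 := integral_nonneg_of_ae hnn
  have hint : Integrable (fun z => (z - m) * Real.exp (-t * z)) μ := by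
    refine ((ct_int μ hΦ ht).sub ((hΦ t ht.le).const_mul m)).congr
      (Eventually.of_forall fun z => ?_)
    simp; ring
  have hlow := ct_lower μ hΦ ht.le (measurableSet_singleton m) (x := m) (by simp)
  have he0 := Real.exp_pos (-t * m)
  have hlog : -t * m ≤ logLapl μ t := by
    rw [logLapl, Real.le_log_iff_exp_le hp]
    nlinarith
  have hd' : deriv (logLapl μ) t = (- ∫ z, z * Real.exp (-t * z) ∂μ) / lapl μ t := hd
  set I := ∫ z, (z - m) * Real.exp (-t * z) ∂μ with hIdef
  have hd2 : deriv (logLapl μ) t = -(I / lapl μ t) - m := by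
    rw [hd', hI]
    generalize (∫ z, z * Real.exp (-t * z) ∂μ) = J
    field_simp; ring
  rw [hd2] at he
  have hq : 0 ≤ I / lapl μ t := by positivity
  have hq0 : I / lapl μ t = 0 := by nlinarith
  have hIz : I = 0 := by
    rcases div_eq_zero_iff.1 hq0 with h | h
    · exact h
    · exact absurd h hp.ne'
  have hz := (integral_eq_zero_iff_of_nonneg_ae hnn hint).1 hIz
  have hae : ∀ᵐ z ∂μ, z ∈ ({m} : Set ℝ) := by
    filter_upwards [hz] with z hz
    have : z - m = 0 := by simpa [(Real.exp_pos (-t * z)).ne'] using hz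
    simpa using sub_eq_zero.1 this
  have hu : μ.real {m} = μ.real univ := measureReal_congr (eventuallyEq_univ.2 hae)
  have hlt : Real.exp (-t * m) < lapl μ t := by
    rw [hu] at hlow; nlinarith
  have : -t * m < logLapl μ t := (Real.lt_log_iff_exp_lt hp).2 hlt
  rw [hq0] at he
  linarith

lemma ct_backward (μ : Measure ℝ) [IsFiniteMeasure μ] (hμ : μ ≠ 0)
    (hΦ : ∀ t : ℝ, 0 ≤ t → Integrable (fun z => Real.exp (-t * z)) μ)
    (hmass : 1 < μ.real univ)
    (hne : ∀ t : ℝ, 0 < t → t * deriv (logLapl μ) t ≠ logLapl μ t) :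
    ∀ x, 0 < μ (Iio x) → ∀ t, 0 < t → -x * t ≤ logLapl μ t := by
  have hD : ∀ t ∈ Ioi (0:ℝ), HasDerivAt (fun t => logLapl μ t / t)
      ((deriv (logLapl μ) t * t - logLapl μ t * 1) / t ^ 2) t := by
    intro t ht
    have hp := ct_pos μ hμ hΦ (le_of_lt ht)
    have h1 : DifferentiableAt ℝ (logLapl μ) t :=
      ((ct_deriv μ hΦ ht).log hp.ne').differentiableAt
    exact h1.hasDerivAt.div (hasDerivAt_id t) (ne_of_gt ht)
  have hcont : ContinuousOn (fun t => logLapl μ t / t) (Ioi 0) :=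
    fun t ht => (hD t ht).continuousAt.continuousWithinAt
  have key : StrictAntiOn (fun t => logLapl μ t / t) (Ioi 0) := by
    rcases hasDerivWithinAt_forall_lt_or_forall_gt_of_forall_ne (convex_Ioi (0:ℝ))
      (fun t ht => (hD t ht).hasDerivWithinAt) (m := 0) (by
        intro t ht h0
        have ht' : (0:ℝ) < t := ht
        rcases div_eq_zero_iff.1 h0 with h | h
        · exact hne t ht (by linarith)
        · exact absurd h (by positivity)) with h | h
    · refine strictAntiOn_of_deriv_neg (convex_Ioi 0) hcont fun t ht => ?_
      rw [interior_Ioi] at ht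
      rw [(hD t ht).deriv]; exact h t ht
    · exfalso
      have hmono : StrictMonoOn (fun t => logLapl μ t / t) (Ioi 0) := by
        refine strictMonoOn_of_deriv_pos (convex_Ioi 0) hcont fun t ht => ?_
        rw [interior_Ioi] at ht
        rw [(hD t ht).deriv]; exact h t ht
      have hl : Tendsto (logLapl μ) (𝓝[>] 0) (𝓝 (Real.log (μ.real univ))) :=
        (ct_tendsto_zero μ hΦ).log (by positivity)
      have hr : Tendsto (fun t => t * logLapl μ 1) (𝓝[>] 0) (𝓝 0) := by
        have : Continuous fun t : ℝ => t * logLapl μ 1 := by fun_prop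
        have := (this.tendsto 0).mono_left (nhdsWithin_le_nhds (s := Ioi 0))
        simpa using this
      have := le_of_tendsto_of_tendsto hl hr (by
        filter_upwards [Ioo_mem_nhdsGT (zero_lt_one (α := ℝ))] with t ht
        have := hmono (mem_Ioi.2 ht.1) (mem_Ioi.2 zero_lt_one) ht.2
        simp only [div_one] at this
        rw [div_lt_iff₀ ht.1] at this
        linarith)
      linarith [Real.log_pos hmass]
  intro x hx t ht
  have hc : 0 < μ.real (Iio x) := by
    rw [measureReal_def]; exact ENNReal.toReal_pos hx.ne' (measure_ne_top _ _)
  have hl : Tendsto (fun s : ℝ => -x + Real.log (μ.real (Iio x)) / s) atTop (𝓝 (-x)) := by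
    have : Tendsto (fun s : ℝ => Real.log (μ.real (Iio x)) / s) atTop (𝓝 0) :=
      tendsto_const_nhds.div_atTop tendsto_id
    simpa using this.const_add (-x)
  have := le_of_tendsto hl (b := logLapl μ t / t) (by
    filter_upwards [eventually_gt_atTop t] with s hs
    have hs0 : 0 < s := ht.trans hs
    have h1 := key (mem_Ioi.2 ht) (mem_Ioi.2 hs0) hs
    have h2 := ct_lower μ hΦ hs0.le measurableSet_Iio (s := Iio x) (x := x)
      (fun z hz => le_of_lt hz)
    have h3 := Real.log_le_log (by positivity) h2
    rw [Real.log_mul (Real.exp_pos _).ne' hc.ne', Real.log_exp] at h3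
    refine le_trans ?_ h1.le
    simp only
    rw [le_div_iff₀ hs0, add_mul, div_mul_cancel₀ _ hs0.ne']
    change _ ≤ logLapl μ s at h3
    linarith)
  rwa [le_div_iff₀ ht] at this

/-- Existence criterion for the critical tilt: there is `t* > 0` with
`t* Ψ'(t*) = Ψ(t*)` iff the support of `μ` is not bounded below, or it is bounded
below and `μ({x_min}) < 1` where `x_min = inf (supp μ)`. -/
theorem critical_tilt_exists_iff
    (μ : Measure ℝ) [IsFiniteMeasure μ] (hμ : μ ≠ 0)
    (hΦ : ∀ t : ℝ, 0 ≤ t → Integrable (fun z => Real.exp (-t * z)) μ)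
    (hmass : 1 < μ Set.univ) (hneg : 0 < μ (Set.Iio 0)) :
    (∃ t : ℝ, 0 < t ∧ t * deriv (logLapl μ) t = logLapl μ t) ↔
      (¬ BddBelow (msupport μ) ∨
        (BddBelow (msupport μ) ∧ μ {sInf (msupport μ)} < 1)) := by
  have hmass' : 1 < μ.real univ := by
    rw [measureReal_def, ← ENNReal.toReal_one]
    exact (ENNReal.toReal_lt_toReal ENNReal.one_ne_top (measure_ne_top _ _)).2 hmass
  constructor
  · rintro ⟨t, ht, he⟩
    by_cases hb : BddBelow (msupport μ)
    · refine Or.inr ⟨hb, ?_⟩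
      have := ct_forward μ hμ hΦ hmass' ht he hb
      rw [measureReal_def, ← ENNReal.toReal_one] at this
      exact (ENNReal.toReal_lt_toReal (measure_ne_top _ _) ENNReal.one_ne_top).1 this
    · exact Or.inl hb
  · intro h
    by_contra! hne
    have key := ct_backward μ hμ hΦ hmass' hne
    rcases h with hb | ⟨hb, ha⟩
    · rw [not_bddBelow_iff] at hb
      obtain ⟨y, hy, hlt⟩ := hb (-(logLapl μ 1) - 1)
      have := key (-(logLapl μ 1) - 1) (ct_iio μ hy hlt) 1 zero_lt_one
      linarith
    · have hm := ct_ae μ hb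
      have hnon : (msupport μ).Nonempty := by
        rw [ct_supp]
        exact Measure.nonempty_support hμ
      have hglb := isGLB_csInf hnon hb
      set m := sInf (msupport μ)
      have ha' : μ.real {m} < 1 := by
        rw [measureReal_def, ← ENNReal.toReal_one]
        exact (ENNReal.toReal_lt_toReal (measure_ne_top _ _) ENNReal.one_ne_top).2 ha
      have hge : ∀ t, 0 < t → -m * t ≤ logLapl μ t := by
        intro t ht
        apply le_of_forall_pos_le_add
        intro ε hε
        obtain ⟨y, hy, -, hlt⟩ := hglb.exists_between
          (show m < m + ε / t by linarith [div_pos hε ht])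
        have := key (m + ε / t) (ct_iio μ hy hlt) t ht
        have e : ε / t * t = ε := div_mul_cancel₀ _ ht.ne'
        linarith
      have hG : ∀ᶠ t : ℝ in atTop, 1 ≤ ∫ z, Real.exp (-t * (z - m)) ∂μ := by
        filter_upwards [eventually_gt_atTop (0:ℝ)] with t ht
        have e : ∫ z, Real.exp (-t * (z - m)) ∂μ = Real.exp (t * m) * lapl μ t := by
          rw [lapl, ← integral_const_mul]
          congr 1; funext z; rw [← Real.exp_add]; congr 1; ring
        rw [e]
        have h1 := (Real.le_log_iff_exp_le (ct_pos μ hμ hΦ ht.le)).1 (hge t ht)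
        calc (1:ℝ) = Real.exp (t * m) * Real.exp (-m * t) := by
              rw [← Real.exp_add, ← Real.exp_zero]; congr 1; ring
          _ ≤ _ := by gcongr
      have := ge_of_tendsto (ct_tendsto_top μ hm) hG
      linarith
end

section
/- Let μ be a finite Borel measure on ℝ with μ(ℝ) > 1 whose topological support is bounded below, set x_min := inf(supp μ), and assume μ({x_min}) ≥ 1. (Then Φ(t) := ∫_ℝ e^{−t z} dμ(z) is automatically finite for all t ≥ 0; set Ψ := log Φ.) Then for every t > 0, t·Ψ'(t) < Ψ(t). -/
open MeasureTheory Filter Set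
open scoped ENNReal

/-- If the support of `μ` is bounded below, `μ(ℝ) > 1` and the atom at `x_min = inf (supp μ)`
has mass at least `1`, then `tΨ'(t) < Ψ(t)` for every `t > 0`. -/
theorem no_critical_tilt_of_large_atom
    (μ : Measure ℝ) [IsFiniteMeasure μ]
    (hmass : 1 < μ Set.univ)
    (hbdd : BddBelow (msupport μ))
    (hatom : 1 ≤ μ {sInf (msupport μ)}) :
    ∀ t : ℝ, 0 < t → t * deriv (logLapl μ) t < logLapl μ t := by
  intro t ht
  set m := sInf (msupport μ) with hm
  have hnull : μ (msupport μ)ᶜ = 0 := by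
    apply measure_null_of_locally_null
    intro x hx
    simp only [msupport, mem_compl_iff, mem_ofPred_eq, not_forall, not_lt] at hx
    obtain ⟨U, hU, h0⟩ := hx
    exact ⟨U, mem_nhdsWithin_of_mem_nhds hU, le_antisymm h0 (zero_le)⟩
  have hae : ∀ᵐ z ∂μ, m ≤ z := by
    have : ∀ᵐ z ∂μ, z ∈ msupport μ := by
      rw [ae_iff]; exact hnull
    filter_upwards [this] with z hz
    exact csInf_le hbdd hz
  have hint : ∀ s : ℝ, s ≤ 0 → Integrable (fun z : ℝ => Real.exp (s * z)) μ := by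
    intro s hs
    refine Integrable.of_bound (C := Real.exp (s * m)) (by fun_prop) ?_
    filter_upwards [hae] with z hz
    rw [Real.norm_eq_abs, abs_of_pos (Real.exp_pos _)]
    exact Real.exp_le_exp.2 (mul_le_mul_of_nonpos_left hz hs)
  have hmem : -t ∈ interior (ProbabilityTheory.integrableExpSet (id : ℝ → ℝ) μ) := by
    refine mem_interior.2 ⟨Iio 0, ?_, isOpen_Iio, by simpa using ht⟩
    intro s hs
    exact hint s (le_of_lt hs)
  have hd0 := ProbabilityTheory.hasDerivAt_mgf hmem
  have hI1 : Integrable (fun z : ℝ => z * Real.exp (-t * z)) μ := by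
    simpa using ProbabilityTheory.integrable_pow_mul_exp_of_mem_interior_integrableExpSet hmem 1
  have hI0 := hint (-t) (by linarith)
  have hd : HasDerivAt (lapl μ) (-∫ z, z * Real.exp (-t * z) ∂μ) t := by
    have := hd0.comp t (hasDerivAt_neg t)
    have he : lapl μ = fun s => ∫ z, Real.exp (-s * z) ∂μ := rfl
    rw [he]
    simpa [ProbabilityTheory.mgf, Function.comp_def] using this
  have hone : (1:ℝ) ≤ μ.real {m} := by
    have := ENNReal.toReal_mono (measure_ne_top μ {m}) hatom
    simpa [Measure.real] using this
  have hsplit : lapl μ t = μ.real {m} * Real.exp (-t * m)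
      + ∫ z in {m}ᶜ, Real.exp (-t * z) ∂μ := by
    rw [lapl, ← integral_add_compl (measurableSet_singleton m) hI0]
    simp [Measure.real]
  have hnn : 0 ≤ ∫ z in {m}ᶜ, Real.exp (-t * z) ∂μ :=
    integral_nonneg fun z => (Real.exp_pos _).le
  have hexp := Real.exp_pos (-t * m)
  have hlt : Real.exp (-t * m) < lapl μ t := by
    by_cases h : μ {m}ᶜ = 0
    · have h1 : 1 < μ {m} := by
        rw [← measure_add_measure_compl (measurableSet_singleton m), h, add_zero] at hmass
        exact hmass
      have h2 : (1:ℝ) < μ.real {m} := by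
        have := (ENNReal.toReal_lt_toReal ENNReal.one_ne_top (measure_ne_top μ {m})).2 h1
        simpa [Measure.real] using this
      rw [hsplit]; nlinarith
    · have : NeZero (μ.restrict {m}ᶜ) := ⟨by simpa [Measure.restrict_eq_zero] using h⟩
      have : 0 < ∫ z in {m}ᶜ, Real.exp (-t * z) ∂μ := integral_exp_pos hI0.integrableOn
      rw [hsplit]; nlinarith
  have hpos : 0 < lapl μ t := hexp.trans hlt
  have hlog : -t * m < logLapl μ t := (Real.lt_log_iff_exp_lt hpos).2 hlt
  have hder : deriv (logLapl μ) t = (-∫ z, z * Real.exp (-t * z) ∂μ) / lapl μ t :=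
    (hd.log hpos.ne').deriv
  have hmono : m * lapl μ t ≤ ∫ z, z * Real.exp (-t * z) ∂μ := by
    rw [lapl, ← integral_const_mul]
    refine integral_mono_ae (hI0.const_mul m) hI1 ?_
    filter_upwards [hae] with z hz
    exact mul_le_mul_of_nonneg_right hz (Real.exp_pos _).le
  have hle : deriv (logLapl μ) t ≤ -m := by
    rw [hder, div_le_iff₀ hpos]; linarith
  nlinarith
end

section
/- Asymptotic slope of the log-Laplace transform: (a) if the topological support of μ is bounded below and x_min := inf(supp μ), then Ψ(t)/t → −x_min as t → ∞; (b) if the topological support of μ is not bounded below, then Ψ(t)/t → +∞ as t → ∞. -/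
open MeasureTheory Filter Set
open scoped ENNReal

lemma lower_aux (μ : Measure ℝ) [IsFiniteMeasure μ]
    (hΦ : ∀ t : ℝ, 0 ≤ t → Integrable (fun z => Real.exp (-t * z)) μ)
    {x c : ℝ} (hx : x ∈ msupport μ) (hc : c < -x) :
    ∀ᶠ t : ℝ in atTop, 0 < lapl μ t ∧ c < logLapl μ t / t := by
  obtain ⟨y, hxy, hyc⟩ := exists_between (show x < -c by linarith)
  have hm : 0 < μ.real (Iio y) :=
    ENNReal.toReal_pos (hx _ (Iio_mem_nhds hxy)).ne' (measure_ne_top _ _)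
  have hlim : Tendsto (fun t : ℝ => Real.log (μ.real (Iio y)) / t + -y) atTop (nhds (0 + -y)) :=
    (tendsto_const_nhds.div_atTop tendsto_id).add tendsto_const_nhds
  filter_upwards [hlim.eventually_const_lt (show c < 0 + -y by linarith), eventually_gt_atTop 0]
    with t ht h0
  have hle : μ.real (Iio y) * Real.exp (-t * y) ≤ lapl μ t := by
    calc μ.real (Iio y) * Real.exp (-t * y) = ∫ z in Iio y, Real.exp (-t * y) ∂μ := by
          simp
      _ ≤ ∫ z in Iio y, Real.exp (-t * z) ∂μ := by
          refine setIntegral_mono_on (integrable_const _) (hΦ t h0.le).integrableOn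
            measurableSet_Iio fun z hz => ?_
          have : z < y := hz
          exact Real.exp_le_exp.2 (by nlinarith)
      _ ≤ lapl μ t := setIntegral_le_integral (hΦ t h0.le)
          (Eventually.of_forall fun z => (Real.exp_pos _).le)
  have hp : 0 < μ.real (Iio y) * Real.exp (-t * y) := by positivity
  refine ⟨hp.trans_le hle, ht.trans_le ?_⟩
  have := Real.log_le_log hp hle
  rw [Real.log_mul hm.ne' (Real.exp_pos _).ne', Real.log_exp] at this
  have e : Real.log (μ.real (Iio y)) / t + -y = (Real.log (μ.real (Iio y)) + -t * y) / t := by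
    field_simp
  rw [e]
  exact div_le_div_of_nonneg_right this h0.le

/-- Asymptotic slope of the log-Laplace transform: `Ψ(t)/t → -x_min` as `t → ∞` when the
support of `μ` is bounded below with infimum `x_min`, and `Ψ(t)/t → +∞` otherwise. -/
theorem logLapl_slope_atTop
    (μ : Measure ℝ) [IsFiniteMeasure μ] (hμ : μ ≠ 0)
    (hΦ : ∀ t : ℝ, 0 ≤ t → Integrable (fun z => Real.exp (-t * z)) μ) :
    (BddBelow (msupport μ) →
      Filter.Tendsto (fun t : ℝ => logLapl μ t / t) Filter.atTop
        (nhds (-(sInf (msupport μ))))) ∧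
    (¬ BddBelow (msupport μ) →
      Filter.Tendsto (fun t : ℝ => logLapl μ t / t) Filter.atTop Filter.atTop) := by
  have hs : msupport μ = μ.support := by
    ext x; rw [Measure.mem_support_iff_forall]; rfl
  have hae : ∀ᵐ z ∂μ, z ∈ msupport μ := by
    rw [hs]; exact Measure.support_mem_ae
  have hne : (msupport μ).Nonempty := by
    haveI : (ae μ).NeBot := ae_neBot.2 hμ
    exact hae.exists
  constructor
  · intro hb
    have hM : 0 < μ.real univ :=
      ENNReal.toReal_pos (by simpa using hμ) (measure_ne_top _ _)
    rw [tendsto_order]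
    constructor
    · intro c hc
      obtain ⟨x, hx, hxc⟩ := exists_lt_of_csInf_lt hne (show sInf (msupport μ) < -c by linarith)
      exact (lower_aux μ hΦ hx (by linarith)).mono fun t h => h.2
    · intro c hc
      set a := sInf (msupport μ) with ha
      obtain ⟨x, hx⟩ := hne
      have hlim : Tendsto (fun t : ℝ => Real.log (μ.real univ) / t + -a) atTop
          (nhds (0 + -a)) :=
        (tendsto_const_nhds.div_atTop tendsto_id).add tendsto_const_nhds
      filter_upwards [hlim.eventually_lt_const (show 0 + -a < c by linarith),
        eventually_gt_atTop 0, lower_aux μ hΦ hx (sub_one_lt (-x))] with t ht h0 hl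
      refine lt_of_le_of_lt ?_ ht
      have hle : lapl μ t ≤ μ.real univ * Real.exp (-t * a) := by
        calc lapl μ t ≤ ∫ z, Real.exp (-t * a) ∂μ := by
              refine integral_mono_ae (hΦ t h0.le) (integrable_const _) ?_
              filter_upwards [hae] with z hz
              have : a ≤ z := csInf_le hb hz
              exact Real.exp_le_exp.2 (by nlinarith)
          _ = _ := by simp
      have := Real.log_le_log hl.1 hle
      rw [Real.log_mul hM.ne' (Real.exp_pos _).ne', Real.log_exp] at this
      have e : Real.log (μ.real univ) / t + -a = (Real.log (μ.real univ) + -t * a) / t := by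
        field_simp
      rw [e]
      exact div_le_div_of_nonneg_right this h0.le
  · intro hb
    rw [tendsto_atTop]
    intro c
    obtain ⟨x, hx, hxc⟩ := not_bddBelow_iff.1 hb (-c)
    exact (lower_aux μ hΦ hx (by linarith)).mono fun t h => h.2.le
end
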